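/- arXiv:1503.03246 — 10 statements merged into one kernel-verified Lean document; each statement's English description precedes it below -/
import Mathlib

section
/- Let φ : X → Y be a continuous map between continua, and suppose Y has more than one composant. Then every composant α of X satisfies: either φ(α) is contained in a proper composant of Y (i.e. a composant different from Y), or φ(α) = Y. -/
open Set Filter Topology

/-- The composant of a point `x` in a continuum `X`: the union of all proper subcontinua of `X`
containing `x`. -/
def composant {X : Type*} [TopologicalSpace X] (x : X) : Set X :=
  {y | ∃ C : Set X, IsCompact C ∧ IsConnected C ∧ C ≠ Set.univ ∧ x ∈ C ∧ y ∈ C}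

/-- If `φ : X → Y` is a continuous map between continua and `Y` has more than one composant,
then each composant of `X` is mapped either into a proper composant of `Y` or onto `Y`. -/
theorem composant_image {X Y : Type*} [MetricSpace X] [CompactSpace X] [ConnectedSpace X]
    [Nonempty X] [MetricSpace Y] [CompactSpace Y] [ConnectedSpace Y] [Nonempty Y]
    {φ : X → Y} (hφ : Continuous φ)
    (hY : ∃ y₁ y₂ : Y, composant y₁ ≠ composant y₂) (x : X) :
    (∃ y : Y, composant y ≠ Set.univ ∧ φ '' composant x ⊆ composant y) ∨
      φ '' composant x = Set.univ := by
  classical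
  by_cases hp : composant (φ x) = Set.univ
  swap
  · by_cases h : ∃ C : Set X, IsCompact C ∧ IsConnected C ∧ C ≠ Set.univ ∧ x ∈ C ∧
        φ '' C = Set.univ
    · right
      obtain ⟨C, h1, h2, h3, h4, h5⟩ := h
      refine Set.eq_univ_of_univ_subset ?_
      rw [← h5]
      exact Set.image_mono fun y hy => ⟨C, h1, h2, h3, h4, hy⟩
    · left
      refine ⟨φ x, hp, ?_⟩
      rintro _ ⟨y, ⟨C, h1, h2, h3, h4, h5⟩, rfl⟩
      exact ⟨φ '' C, h1.image hφ, h2.image _ hφ.continuousOn,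
        fun h6 => h ⟨C, h1, h2, h3, h4, h6⟩, ⟨x, h4, rfl⟩, ⟨y, h5, rfl⟩⟩
  · obtain ⟨a, ha⟩ : ∃ a : Y, composant a ≠ Set.univ := by
      by_contra hcon
      push Not at hcon
      obtain ⟨y₁, y₂, h⟩ := hY
      exact h ((hcon y₁).trans (hcon y₂).symm)
    obtain ⟨b, hb⟩ : ∃ b, b ∉ composant a := (Set.ne_univ_iff_exists_notMem _).1 ha
    have hab : a ∉ composant b := by
      rintro ⟨C, h1, h2, h3, h4, h5⟩
      exact hb ⟨C, h1, h2, h3, h5, h4⟩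
    have hb' : composant b ≠ Set.univ := (Set.ne_univ_iff_exists_notMem _).2 ⟨a, hab⟩
    by_cases hA : φ '' composant x ⊆ composant a
    · exact Or.inl ⟨a, ha, hA⟩
    by_cases hB : φ '' composant x ⊆ composant b
    · exact Or.inl ⟨b, hb', hB⟩
    right
    obtain ⟨_, ⟨z, ⟨C, c1, c2, c3, c4, c5⟩, rfl⟩, hz⟩ := Set.not_subset.1 hA
    obtain ⟨_, ⟨w, ⟨D, d1, d2, d3, d4, d5⟩, rfl⟩, hw⟩ := Set.not_subset.1 hB
    have hKc : IsCompact (φ '' (C ∪ D)) := (c1.union d1).image hφ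
    have hKn : IsConnected (φ '' (C ∪ D)) :=
      (IsConnected.union ⟨x, c4, d4⟩ c2 d2).image _ hφ.continuousOn
    have hxK : φ x ∈ φ '' (C ∪ D) := ⟨x, Or.inl c4, rfl⟩
    have hzK : φ z ∈ φ '' (C ∪ D) := ⟨z, Or.inl c5, rfl⟩
    have hwK : φ w ∈ φ '' (C ∪ D) := ⟨w, Or.inr d5, rfl⟩
    by_cases hK : φ '' (C ∪ D) = Set.univ
    · refine Set.eq_univ_of_univ_subset ?_
      rw [← hK]
      refine Set.image_mono ?_
      rintro y (hy | hy)
      · exact ⟨C, c1, c2, c3, c4, hy⟩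
      · exact ⟨D, d1, d2, d3, d4, hy⟩
    · exfalso
      have hap : a ∈ composant (φ x) := by rw [hp]; trivial
      obtain ⟨A, a1, a2, a3, a4, a5⟩ := hap
      have hU : φ '' (C ∪ D) ∪ A = Set.univ := by
        by_contra hU
        exact hz ⟨_, hKc.union a1, IsConnected.union ⟨φ x, hxK, a4⟩ hKn a2, hU,
          Or.inr a5, Or.inl hzK⟩
      have hbU : b ∈ φ '' (C ∪ D) ∪ A := by rw [hU]; trivial
      rcases hbU with h | h
      · exact hw ⟨_, hKc, hKn, hK, h, hwK⟩
      · exact hb ⟨A, a1, a2, a3, a5, h⟩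
end

section
/- If X is a decomposable continuum having exactly three composants, then there is no minimal continuous map T : X → X. -/
open Set Filter Topology

/-- A self-map of a topological space is minimal if every forward orbit is dense. -/
def IsMinimal {X : Type*} [TopologicalSpace X] (T : X → X) : Prop :=
  ∀ x : X, Dense (Set.range fun n : ℕ => T^[n] x)

/-- The forward invariant closed nonempty sets of a minimal map are everything. -/
lemma minimal_closed {X : Type*} [TopologicalSpace X] {S : X → X} (hS : IsMinimal S)
    {F : Set X} (hF : IsClosed F) (hne : F.Nonempty) (hinv : ∀ x ∈ F, S x ∈ F) : F = univ := by
  obtain ⟨x, hx⟩ := hne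
  have h : range (fun n : ℕ => S^[n] x) ⊆ F := by
    rintro _ ⟨n, rfl⟩
    induction n with
    | zero => exact hx
    | succ n ih =>
      simp only [Function.iterate_succ_apply']
      exact hinv _ ih
  have := hF.closure_subset_iff.2 h
  rw [(hS x).closure_eq] at this
  exact univ_subset_iff.1 this

lemma minimal_surj {X : Type*} [TopologicalSpace X] [CompactSpace X] [T2Space X] [Nonempty X]
    {S : X → X} (hc : Continuous S) (hS : IsMinimal S) : Function.Surjective S := by
  rw [← range_eq_univ]
  exact minimal_closed hS (isCompact_range hc).isClosed (range_nonempty S)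
    (fun x _ => mem_range_self x)

lemma minimal_cover {X : Type*} [TopologicalSpace X] [CompactSpace X]
    {S : X → X} (hc : Continuous S) (hS : IsMinimal S) {U : Set X} (hU : IsOpen U)
    (hne : U.Nonempty) : ∃ N : ℕ, ∀ x, ∃ n < N, S^[n] x ∈ U := by
  have h := isCompact_univ.elim_finite_subcover (fun n : ℕ => S^[n] ⁻¹' U)
    (fun n => hU.preimage (hc.iterate n)) (by
      intro x _
      obtain ⟨y, hy, n, rfl⟩ := (hS x).inter_open_nonempty U hU hne
      exact mem_iUnion.2 ⟨n, hy⟩)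
  obtain ⟨t, ht⟩ := h
  refine ⟨t.sup id + 1, fun x => ?_⟩
  obtain ⟨n, hn, hx⟩ := mem_iUnion₂.1 (ht (mem_univ x))
  exact ⟨n, Nat.lt_succ_of_le (Finset.le_sup (f := id) hn), hx⟩

/-- A minimal map is irreducible: no proper closed set is mapped onto the space. -/
lemma minimal_irred {X : Type*} [TopologicalSpace X] [CompactSpace X] [Nonempty X]
    {S : X → X} (hc : Continuous S) (hS : IsMinimal S) {F : Set X} (hF : IsClosed F)
    (hne : F ≠ univ) : S '' F ≠ univ := by
  intro h
  obtain ⟨N, hN⟩ := minimal_cover hc hS hF.isOpen_compl (nonempty_compl.2 hne)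
  have key : ∀ n : ℕ, ∃ x, ∀ k < n, S^[k] x ∈ F := by
    intro n
    induction n with
    | zero => exact ⟨Classical.arbitrary X, fun k hk => absurd hk (Nat.not_lt_zero k)⟩
    | succ n ih =>
      obtain ⟨x, hx⟩ := ih
      obtain ⟨y, hy, rfl⟩ : x ∈ S '' F := h ▸ mem_univ x
      refine ⟨y, fun k hk => ?_⟩
      cases k with
      | zero => exact hy
      | succ k =>
        rw [Function.iterate_succ_apply]
        exact hx k (by omega)
  obtain ⟨x, hx⟩ := key N
  obtain ⟨n, hn, h'⟩ := hN x
  exact h' (hx n hn)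

lemma minimal_sq {X : Type*} [TopologicalSpace X] [CompactSpace X] [ConnectedSpace X]
    {S : X → X} (hc : Continuous S) (hS : IsMinimal S) : IsMinimal (fun x => S (S x)) := by
  intro x
  set R : X → X := fun x => S (S x) with hR
  have hcR : Continuous R := hc.comp hc
  have hinv : ∀ y, ∀ z ∈ closure (range fun n : ℕ => R^[n] y),
      S z ∈ closure (range fun n : ℕ => R^[n] (S y)) := by
    intro y z hz
    refine map_mem_closure hc hz ?_
    rintro _ ⟨n, rfl⟩
    refine ⟨n, ?_⟩
    have : Function.Commute S R := fun _ => rfl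
    exact ((this.iterate_right n) y).symm
  have hsub : ∀ y, closure (range fun n : ℕ => R^[n] (R y)) ⊆
      closure (range fun n : ℕ => R^[n] y) := by
    intro y
    apply closure_mono
    rintro _ ⟨n, rfl⟩
    exact ⟨n + 1, rfl⟩
  set F0 := closure (range fun n : ℕ => R^[n] x) with hF0
  set F1 := closure (range fun n : ℕ => R^[n] (S x)) with hF1
  have h01 : ∀ z ∈ F0, S z ∈ F1 := hinv x
  have h10 : ∀ z ∈ F1, S z ∈ F0 := fun z hz => hsub x (hinv (S x) z hz)
  have n0 : F0.Nonempty := (range_nonempty _).closure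
  have n1 : F1.Nonempty := (range_nonempty _).closure
  have hun : F0 ∪ F1 = univ := minimal_closed hS (isClosed_closure.union isClosed_closure)
    (n0.mono subset_union_left)
    (fun z hz => hz.elim (fun h => Or.inr (h01 z h)) (fun h => Or.inl (h10 z h)))
  have hint : (F0 ∩ F1).Nonempty := by
    have := isPreconnected_closed_iff.1 (isPreconnected_univ (α := X)) F0 F1 isClosed_closure
      isClosed_closure hun.ge (by simpa using n0) (by simpa using n1)
    simpa using this
  have hall : F0 ∩ F1 = univ := minimal_closed hS (isClosed_closure.inter isClosed_closure) hint
    (fun z hz => ⟨h10 z hz.2, h01 z hz.1⟩)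
  rw [dense_iff_closure_eq]
  exact univ_subset_iff.1 (hall ▸ inter_subset_left)

lemma composant_map {X : Type*} [TopologicalSpace X] [CompactSpace X] [T2Space X] [Nonempty X]
    {S : X → X} (hc : Continuous S) (hS : IsMinimal S) {x y : X} (h : y ∈ composant x) :
    S y ∈ composant (S x) := by
  obtain ⟨C, h1, h2, h3, h4, h5⟩ := h
  exact ⟨S '' C, h1.image hc, h2.image S hc.continuousOn, minimal_irred hc hS h1.isClosed h3,
    mem_image_of_mem S h4, mem_image_of_mem S h5⟩

lemma no_inv {X : Type*} [TopologicalSpace X] [CompactSpace X] [T2Space X] [Nonempty X]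
    {S : X → X} (hc : Continuous S) (hS : IsMinimal S) {K B : Set X} (hB : IsClosed B)
    (hne : B ≠ univ) (hK : Bᶜ ⊆ K) {q : X} (hq : q ∉ K) (hinv : ∀ x ∈ K, S x ∈ K) : False := by
  obtain ⟨N, hN⟩ := minimal_cover hc hS hB.isOpen_compl (nonempty_compl.2 hne)
  obtain ⟨x, rfl⟩ := (minimal_surj hc hS).iterate N q
  obtain ⟨n, hn, hx⟩ := hN x
  apply hq
  obtain ⟨m, rfl⟩ := Nat.exists_eq_add_of_lt hn
  have key : ∀ k, S^[k + n] x ∈ K := by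
    intro k
    induction k with
    | zero => simpa using hK hx
    | succ k ih =>
      rw [Nat.add_right_comm, Function.iterate_succ_apply']
      exact hinv _ ih
  have := key (m + 1)
  rwa [show n + m + 1 = m + 1 + n by omega]

lemma composant_symm {X : Type*} [TopologicalSpace X] {x y : X} (h : y ∈ composant x) :
    x ∈ composant y := by
  obtain ⟨C, h1, h2, h3, h4, h5⟩ := h
  exact ⟨C, h1, h2, h3, h5, h4⟩

lemma main_aux {X : Type*} [MetricSpace X] [CompactSpace X]
    [ConnectedSpace X] [Nonempty X] {A B : Set X} (hA : IsCompact A) (hA' : IsConnected A)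
    (hAn : A ≠ univ) (hB : IsCompact B) (hB' : IsConnected B) (hBn : B ≠ univ)
    (hAB : A ∪ B = univ)
    (h3 : {S : Set X | ∃ x : X, S = composant x}.ncard = 3)
    {p q : X} (hp : p ∈ A) (hq : q ∈ B) (hpq : q ∉ composant p)
    {T : X → X} (hc : Continuous T) (hT : IsMinimal T) : False := by
  have hqp : p ∉ composant q := fun h => hpq (composant_symm h)
  have hAp : A ⊆ composant p := fun y hy => ⟨A, hA, hA', hAn, hp, hy⟩
  have hBq : B ⊆ composant q := fun y hy => ⟨B, hB, hB', hBn, hq, hy⟩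
  have hAc : Aᶜ ⊆ composant q := fun y hy =>
    hBq (((hAB ▸ mem_univ y : y ∈ A ∪ B)).resolve_left hy)
  have hBc : Bᶜ ⊆ composant p := fun y hy =>
    hAp (((hAB ▸ mem_univ y : y ∈ A ∪ B)).resolve_right hy)
  obtain ⟨m, hmA, hmB⟩ : (A ∩ B).Nonempty := by
    have := isPreconnected_closed_iff.1 (isPreconnected_univ (α := X)) A B hA.isClosed
      hB.isClosed hAB.ge ⟨p, mem_univ _, hp⟩ ⟨q, mem_univ _, hq⟩
    simpa using this
  have hm : composant m = univ := by
    refine eq_univ_of_forall fun y => ?_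
    rcases (hAB ▸ mem_univ y : y ∈ A ∪ B) with h | h
    · exact ⟨A, hA, hA', hAn, hmA, h⟩
    · exact ⟨B, hB, hB', hBn, hmB, h⟩
  have hpp : p ∈ composant p := hAp hp
  have hqq : q ∈ composant q := hBq hq
  have hne1 : composant p ≠ composant q := fun h => hqp (h ▸ hpp)
  have hne2 : composant p ≠ univ := fun h => hpq (h ▸ mem_univ q)
  have hne3 : composant q ≠ univ := fun h => hqp (h ▸ mem_univ p)
  have hset : ({composant p, composant q, univ} : Set (Set X)) =
      {S : Set X | ∃ x : X, S = composant x} := by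
    refine Set.eq_of_subset_of_ncard_le ?_ ?_ (Set.finite_of_ncard_ne_zero (by rw [h3]; decide))
    · rintro S (rfl | rfl | rfl)
      · exact ⟨p, rfl⟩
      · exact ⟨q, rfl⟩
      · exact ⟨m, hm.symm⟩
    · rw [h3, Set.ncard_eq_three.2 ⟨_, _, _, hne1, hne2, hne3, rfl⟩]
  have hthree : ∀ x : X, composant x = composant p ∨ composant x = composant q ∨
      composant x = univ := by
    intro x
    have : composant x ∈ ({composant p, composant q, univ} : Set (Set X)) := hset ▸ ⟨x, rfl⟩
    simpa using this
  obtain ⟨p', hp'⟩ := minimal_surj hc hT p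
  obtain ⟨q', hq'⟩ := minimal_surj hc hT q
  have mp : ∀ x ∈ composant p', T x ∈ composant p := fun x hx => hp' ▸ composant_map hc hT hx
  have mq : ∀ x ∈ composant q', T x ∈ composant q := fun x hx => hq' ▸ composant_map hc hT hx
  rcases hthree p' with h | h | h
  · rw [h] at mp
    exact no_inv hc hT hB.isClosed hBn hBc hpq mp
  · rcases hthree q' with k | k | k
    · rw [h] at mp
      rw [k] at mq
      exact no_inv (hc.comp hc) (minimal_sq hc hT) hB.isClosed hBn hBc hpq
        (fun x hx => mp _ (mq _ hx))
    · rw [k] at mq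
      exact no_inv hc hT hA.isClosed hAn hAc hqp mq
    · exact hqp (hp' ▸ mq p' (k ▸ mem_univ p'))
  · exact hpq (hq' ▸ mp q' (h ▸ mem_univ q'))

/-- A decomposable continuum with exactly three composants admits no minimal continuous map. -/
theorem no_minimal_map_of_three_composants {X : Type*} [MetricSpace X] [CompactSpace X]
    [ConnectedSpace X] [Nonempty X]
    (hdec : ∃ A B : Set X, IsCompact A ∧ IsConnected A ∧ A ≠ Set.univ ∧
      IsCompact B ∧ IsConnected B ∧ B ≠ Set.univ ∧ A ∪ B = Set.univ)
    (h3 : {S : Set X | ∃ x : X, S = composant x}.ncard = 3) :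
    ¬ ∃ T : X → X, Continuous T ∧ IsMinimal T := by
  rintro ⟨T, hc, hT⟩
  obtain ⟨A, B, hA, hA', hAn, hB, hB', hBn, hAB⟩ := hdec
  obtain ⟨p, q, hpq⟩ : ∃ p q : X, q ∉ composant p := by
    by_contra! hcon
    have hsub : {S : Set X | ∃ x : X, S = composant x} ⊆ {univ} := by
      rintro S ⟨x, rfl⟩
      exact eq_univ_of_forall (hcon x)
    have := Set.ncard_le_ncard hsub (Set.finite_singleton _)
    rw [h3, Set.ncard_singleton] at this
    omega
  rcases (hAB ▸ mem_univ p : p ∈ A ∪ B) with h | h <;>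
    rcases (hAB ▸ mem_univ q : q ∈ A ∪ B) with k | k
  · exact hpq ⟨A, hA, hA', hAn, h, k⟩
  · exact main_aux hA hA' hAn hB hB' hBn hAB h3 h k hpq hc hT
  · exact main_aux hB hB' hBn hA hA' hAn (union_comm A B ▸ hAB) h3 h k hpq hc hT
  · exact hpq ⟨B, hB, hB', hBn, h, k⟩
end

section
/- Let X be a compact zero-dimensional metric space and T : X → X a homeomorphism. Then the family {T^n : n ∈ ℤ} of all forward and backward iterates of T is equicontinuous if and only if every point x ∈ X is periodically recurrent under T. -/
open Set Filter Topology

/-- Integer powers (iterates) of a self-homeomorphism: `hzpow T n = Tⁿ` for `n : ℤ`. -/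
def hzpow {X : Type*} [TopologicalSpace X] (T : X ≃ₜ X) : ℤ → (X ≃ₜ X)
  | Int.ofNat n => (fun S => S.trans T)^[n] (Homeomorph.refl X)
  | Int.negSucc n => ((fun S => S.trans T)^[n + 1] (Homeomorph.refl X)).symm

theorem hzpow_aux_coe {X : Type*} [TopologicalSpace X] (T : X ≃ₜ X) (n : ℕ) :
    ((fun S : X ≃ₜ X => S.trans T)^[n] (Homeomorph.refl X)).toEquiv
      = (T.toEquiv : Equiv.Perm X) ^ n := by
  induction n with
  | zero => rfl
  | succ n ih =>
    rw [Function.iterate_succ_apply', pow_succ', ← ih]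
    rfl

theorem hzpow_eq_zpow {X : Type*} [TopologicalSpace X] (T : X ≃ₜ X) (n : ℤ) :
    (hzpow T n).toEquiv = (T.toEquiv : Equiv.Perm X) ^ n := by
  cases n with
  | ofNat n => exact (hzpow_aux_coe T n).trans (zpow_natCast _ n).symm
  | negSucc n =>
    rw [zpow_negSucc, ← hzpow_aux_coe]
    rfl

theorem hzpow_add_apply {X : Type*} [TopologicalSpace X] (T : X ≃ₜ X) (m n : ℤ) (x : X) :
    hzpow T (m + n) x = hzpow T m (hzpow T n x) := by
  have h : ∀ (n : ℤ) (x : X), hzpow T n x = ((T.toEquiv : Equiv.Perm X) ^ n) x := fun n x => by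
    rw [← hzpow_eq_zpow]; rfl
  rw [h, h, h, zpow_add]; rfl

theorem hzpow_natCast_apply {X : Type*} [TopologicalSpace X] (T : X ≃ₜ X) (n : ℕ) (x : X) :
    hzpow T (n : ℤ) x = (⇑T)^[n] x := by
  induction n with
  | zero => rfl
  | succ n ih =>
    rw [Function.iterate_succ_apply', ← ih, Nat.cast_succ, add_comm, hzpow_add_apply]
    rfl

/-- Forward direction. -/
theorem recurrent_of_equicontinuous {X : Type*} [MetricSpace X] [CompactSpace X]
    (hzd : ∀ x : X, ∀ U ∈ 𝓝 x, ∃ V : Set X, IsClopen V ∧ x ∈ V ∧ V ⊆ U)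
    (T : X ≃ₜ X) (h : Equicontinuous (fun n : ℤ => ⇑(hzpow T n)))
    (x : X) (U : Set X) (hU : IsOpen U) (hx : x ∈ U) :
    ∃ k : ℕ, 1 ≤ k ∧ ∀ n : ℕ, (⇑T)^[k * n] x ∈ U := by
  obtain ⟨V, hV, hxV, hVU⟩ := hzd x U (hU.mem_nhds hx)
  have hue := CompactSpace.uniformEquicontinuous_of_equicontinuous h
  obtain ⟨ε, hε, hεV⟩ := hV.isClosed.isCompact.exists_thickening_subset_open hV.isOpen subset_rfl
  have hεV : ∀ y z, dist y z < ε → y ∈ V → z ∈ V := fun y z hyz hy =>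
    hεV (Metric.mem_thickening_iff.2 ⟨y, hy, by rwa [dist_comm]⟩)
  obtain ⟨δ, hδ, hd⟩ := Metric.uniformEquicontinuous_iff.1 hue ε hε
  obtain ⟨a, φ, hφ, hlim⟩ := CompactSpace.tendsto_subseq (fun n : ℕ => (⇑T)^[n] x)
  obtain ⟨N, hN⟩ := Metric.cauchySeq_iff.1 hlim.cauchySeq δ hδ
  have hij : φ N < φ (N + 1) := hφ (Nat.lt_succ_self N)
  have hc := hN N le_rfl (N + 1) (Nat.le_succ N)
  simp only [Function.comp] at hc
  obtain ⟨k, hk⟩ := Nat.exists_eq_add_of_lt hij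
  refine ⟨k + 1, by omega, fun n => hVU ?_⟩
  induction n with
  | zero => simpa using hxV
  | succ n ih =>
    have h1 := hd _ _ hc (((k + 1) * n : ℕ) - (φ N : ℤ))
    rw [← hzpow_natCast_apply, ← hzpow_natCast_apply, ← hzpow_add_apply, ← hzpow_add_apply] at h1
    have e1 : (((k + 1) * n : ℕ) : ℤ) - (φ N : ℤ) + (φ N : ℤ) = ((k + 1) * n : ℕ) := by ring
    have e2 : (((k + 1) * n : ℕ) : ℤ) - (φ N : ℤ) + (φ (N + 1) : ℤ)
        = ((k + 1) * (n + 1) : ℕ) := by rw [hk]; push_cast; ring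
    rw [e1, e2, hzpow_natCast_apply, hzpow_natCast_apply] at h1
    exact hεV _ _ h1 ih

/-- For a clopen `V`, a finite block of the future itinerary determines the present. -/
theorem exists_window {X : Type*} [MetricSpace X] [CompactSpace X] (T : X ≃ₜ X)
    (h : ∀ x : X, ∀ U : Set X, IsOpen U → x ∈ U →
        ∃ k : ℕ, 1 ≤ k ∧ ∀ n : ℕ, (⇑T)^[k * n] x ∈ U) (V : Set X) (hV : IsClopen V) :
    ∃ N : ℕ, ∀ x y : X, (∀ i < N, ((⇑T)^[i + 1] x ∈ V ↔ (⇑T)^[i + 1] y ∈ V)) →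
      x ∈ V → y ∈ V := by
  by_contra! hcon
  let C : ℕ → Set (X × X) := fun N =>
    {p | (∀ i < N, ((⇑T)^[i + 1] p.1 ∈ V ↔ (⇑T)^[i + 1] p.2 ∈ V)) ∧ p.1 ∈ V ∧ p.2 ∉ V}
  have hcont : ∀ i, Continuous ((⇑T)^[i]) := fun i => T.continuous.iterate i
  have hcl : ∀ N, IsClosed (C N) := by
    intro N
    have : C N = (⋂ i, ⋂ (_ : i < N),
        ((fun p : X × X => (⇑T)^[i + 1] p.1) ⁻¹' V ∩ (fun p : X × X => (⇑T)^[i + 1] p.2) ⁻¹' V) ∪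
        ((fun p : X × X => (⇑T)^[i + 1] p.1) ⁻¹' Vᶜ ∩ (fun p : X × X => (⇑T)^[i + 1] p.2) ⁻¹' Vᶜ))
        ∩ (Prod.fst ⁻¹' V ∩ Prod.snd ⁻¹' Vᶜ) := by
      ext p
      simp only [C, mem_setOf_eq, mem_inter_iff, mem_iInter, mem_union, mem_preimage,
        mem_compl_iff, iff_iff_and_or_not_and_not]
    rw [this]
    have c1 : ∀ i, Continuous (fun p : X × X => (⇑T)^[i + 1] p.1) :=
      fun i => (hcont _).comp continuous_fst
    have c2 : ∀ i, Continuous (fun p : X × X => (⇑T)^[i + 1] p.2) :=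
      fun i => (hcont _).comp continuous_snd
    refine IsClosed.inter (isClosed_iInter fun i => isClosed_iInter fun _ => ?_) ?_
    · exact ((hV.isClosed.preimage (c1 i)).inter (hV.isClosed.preimage (c2 i))).union
        ((hV.compl.isClosed.preimage (c1 i)).inter (hV.compl.isClosed.preimage (c2 i)))
    · exact (hV.isClosed.preimage continuous_fst).inter
        (hV.compl.isClosed.preimage continuous_snd)
  obtain ⟨⟨x, y⟩, hp⟩ := IsCompact.nonempty_iInter_of_sequence_nonempty_isCompact_isClosed C
    (fun N p hp => ⟨fun i hi => hp.1 i (by omega), hp.2⟩)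
    (fun N => by
      obtain ⟨x, y, h1, h2, h3⟩ := hcon N
      exact ⟨(x, y), h1, h2, h3⟩)
    (hcl 0).isCompact hcl
  rw [mem_iInter] at hp
  obtain ⟨k, hk, hk'⟩ := h x V hV.isOpen (hp 0).2.1
  obtain ⟨l, hl, hl'⟩ := h y Vᶜ hV.compl.isOpen (hp 0).2.2
  have hpos : 0 < k * l := Nat.mul_pos hk hl
  have := (hp (k * l)).1 (k * l - 1) (by omega)
  rw [Nat.sub_add_cancel hpos] at this
  refine hl' k ?_
  rw [mul_comm]
  exact this.1 (hk' l)

/-- For a clopen `V`, points close to `x` have the same two-sided itinerary. -/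
theorem eventually_same_itinerary {X : Type*} [MetricSpace X] [CompactSpace X] (T : X ≃ₜ X)
    (h : ∀ x : X, ∀ U : Set X, IsOpen U → x ∈ U →
        ∃ k : ℕ, 1 ≤ k ∧ ∀ n : ℕ, (⇑T)^[k * n] x ∈ U) (V : Set X) (hV : IsClopen V) (x : X) :
    ∀ᶠ y in 𝓝 x, ∀ n : ℤ, hzpow T n x ∈ V → hzpow T n y ∈ V := by
  classical
  obtain ⟨N, hN⟩ := exists_window T h V hV
  let w : X → (Fin N → Prop) := fun x i => (⇑T)^[(i : ℕ) + 1] x ∈ V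
  have hw : ∀ x y, w x = w y → (x ∈ V ↔ y ∈ V) := by
    intro x y hxy
    have h1 : ∀ i < N, ((⇑T)^[i + 1] x ∈ V ↔ (⇑T)^[i + 1] y ∈ V) := fun i hi =>
      iff_of_eq (congrFun hxy ⟨i, hi⟩)
    exact ⟨hN x y h1, hN y x fun i hi => (h1 i hi).symm⟩
  have hback : ∀ x y, w (T x) = w (T y) → w x = w y := by
    intro x y hxy
    have hz := hw _ _ hxy
    funext i
    apply propext
    rcases i with ⟨i, hi⟩
    cases i with
    | zero => exact hz
    | succ j =>
      have := iff_of_eq (congrFun hxy ⟨j, by omega⟩)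
      exact this
  have hfwd : ∀ x y, w x = w y → w (T x) = w (T y) := by
    let f : range w → range w := fun a => ⟨w (T.symm a.2.choose), mem_range_self _⟩
    have hf : ∀ x, f ⟨w (T x), mem_range_self _⟩ = ⟨w x, mem_range_self _⟩ := by
      intro x
      apply Subtype.ext
      apply hback
      have hs := (mem_range_self (f := w) (T x)).choose_spec
      rw [T.apply_symm_apply]
      exact hs
    have hsurj : Function.Surjective f := by
      rintro ⟨_, x, rfl⟩
      exact ⟨_, hf x⟩
    have hinj : Function.Injective f := Finite.injective_iff_surjective.2 hsurj
    intro x y hxy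
    have : f ⟨w (T x), mem_range_self _⟩ = f ⟨w (T y), mem_range_self _⟩ := by
      rw [hf, hf]; exact Subtype.ext hxy
    exact congrArg Subtype.val (hinj this)
  have hall : ∀ n : ℤ, ∀ x y, w x = w y → w (hzpow T n x) = w (hzpow T n y) := by
    intro n x y hxy
    have hstep : ∀ (m : ℤ) (z : X), hzpow T (m + 1) z = T (hzpow T m z) := fun m z => by
      rw [add_comm, hzpow_add_apply]; rfl
    induction n using Int.induction_on with
    | zero => exact hxy
    | succ n ih => rw [hstep, hstep]; exact hfwd _ _ ih
    | pred n ih =>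
      apply hback
      rw [← hstep, ← hstep, sub_add_cancel]
      exact ih
  have hev : ∀ᶠ y in 𝓝 x, w x = w y := by
    have : ∀ i : Fin N, ∀ᶠ y in 𝓝 x, w x i = w y i := by
      intro i
      have hc : IsClopen ((⇑T)^[(i : ℕ) + 1] ⁻¹' V) := hV.preimage (T.continuous.iterate _)
      by_cases hx : x ∈ (⇑T)^[(i : ℕ) + 1] ⁻¹' V
      · filter_upwards [hc.isOpen.mem_nhds hx] with y hy
        exact propext ⟨fun _ => hy, fun _ => hx⟩
      · filter_upwards [hc.compl.isOpen.mem_nhds hx] with y hy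
        exact propext ⟨fun a => absurd a hx, fun a => absurd a hy⟩
    filter_upwards [eventually_all.2 this] with y hy
    exact funext hy
  filter_upwards [hev] with y hy n
  exact (hw _ _ (hall n _ _ hy)).1

/-- On a compact zero-dimensional metric space, a homeomorphism `T` is equicontinuous
(the family of all its forward and backward iterates is equicontinuous) if and only if every
point is periodically recurrent under `T`. -/
theorem equicontinuous_iff_periodically_recurrent {X : Type*} [MetricSpace X] [CompactSpace X]
    (hzd : ∀ x : X, ∀ U ∈ 𝓝 x, ∃ V : Set X, IsClopen V ∧ x ∈ V ∧ V ⊆ U)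
    (T : X ≃ₜ X) :
    Equicontinuous (fun n : ℤ => ⇑(hzpow T n)) ↔
      ∀ x : X, ∀ U : Set X, IsOpen U → x ∈ U →
        ∃ k : ℕ, 1 ≤ k ∧ ∀ n : ℕ, (⇑T)^[k * n] x ∈ U := by
  refine ⟨fun h x U hU hx => recurrent_of_equicontinuous hzd T h x U hU hx, fun h x => ?_⟩
  rw [Metric.equicontinuousAt_iff_right]
  intro ε hε
  choose V hV hxV hVU using fun z : X => hzd z (Metric.ball z (ε / 2))
    (Metric.ball_mem_nhds z (half_pos hε))
  obtain ⟨t, ht⟩ := isCompact_univ.elim_finite_subcover V (fun z => (hV z).isOpen)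
    (fun z _ => mem_iUnion.2 ⟨z, hxV z⟩)
  have hev : ∀ᶠ y in 𝓝 x, ∀ z ∈ t, ∀ n : ℤ, hzpow T n x ∈ V z → hzpow T n y ∈ V z :=
    (Filter.eventually_all_finset t).2 fun z _ => eventually_same_itinerary T h (V z) (hV z) x
  filter_upwards [hev] with y hy n
  obtain ⟨z, hz, hxz⟩ := mem_iUnion₂.1 (ht (mem_univ (hzpow T n x)))
  have h1 := Metric.mem_ball.1 (hVU z hxz)
  have h2 := Metric.mem_ball'.1 (hVU z (hy z hz n hxz))
  have := dist_triangle (hzpow T n x) z (hzpow T n y)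
  linarith
end

section
/- Let X be a compact zero-dimensional metric space and T : X → X an equicontinuous homeomorphism (i.e. the family {T^n : n ∈ ℤ} is equicontinuous). Then the topological entropy of F_T on C(X,X) is zero, and the topological entropy of F_T on H(X,X) is zero. -/
open Set Filter Topology

/-- `E` is an `(n, ε)`-separated set for the map `S`: any two distinct points of `E` are more
than `ε` apart in the dynamical metric `max_{0 ≤ j < n} dist (S^j x) (S^j y)`. -/
def IsDynSep {Z : Type*} [PseudoMetricSpace Z] (S : Z → Z) (n : ℕ) (ε : ℝ) (E : Set Z) : Prop :=
  ∀ x ∈ E, ∀ y ∈ E, x ≠ y → ∃ j < n, ε < dist (S^[j] x) (S^[j] y)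

/-- The maximal cardinality `sep(n, ε; K)` of an `(n, ε)`-separated subset of `K`. -/
noncomputable def sepNum {Z : Type*} [PseudoMetricSpace Z] (S : Z → Z) (n : ℕ) (ε : ℝ)
    (K : Set Z) : ℕ :=
  sSup {m : ℕ | ∃ E : Finset Z, ↑E ⊆ K ∧ IsDynSep S n ε ↑E ∧ E.card = m}

/-- The topological entropy of `S` on the set `K`:
`lim_{ε → 0} limsup_n (1/n) log sep(n, ε; K)`; the limit as `ε → 0` is realized as the
supremum over `ε > 0`, the quantity being monotone in `ε`. -/
noncomputable def entropyOnSet {Z : Type*} [PseudoMetricSpace Z] (S : Z → Z) (K : Set Z) :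
    EReal :=
  ⨆ (ε : ℝ) (_ : 0 < ε),
    Filter.atTop.limsup fun n : ℕ => ((Real.log (sepNum S n ε K) / n : ℝ) : EReal)

/-- The topological entropy of the restriction of `S` to a subset `A` of its domain:
the supremum of the entropies on all compact subsets of `A`. -/
noncomputable def entropyOn {Z : Type*} [PseudoMetricSpace Z] (S : Z → Z) (A : Set Z) : EReal :=
  ⨆ (K : Set Z) (_ : IsCompact K) (_ : K ⊆ A), entropyOnSet S K

/-- The topological entropy of `S`: the supremum of the entropies on all compact sets. -/
noncomputable def dynEntropy {Z : Type*} [PseudoMetricSpace Z] (S : Z → Z) : EReal :=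
  ⨆ (K : Set Z) (_ : IsCompact K), entropyOnSet S K

/-- The set `H(X,X)` of self-homeomorphisms of `X`, viewed inside `C(X,X)` (so that, for `X`
compact metric, it inherits the uniform metric `D(φ,ψ) = sup_x d(φ x, ψ x)`). -/
def HSet (X : Type*) [TopologicalSpace X] : Set C(X, X) := {f | IsHomeomorph f}

/-- The functional envelope map `F_T : φ ↦ T ∘ φ` on `C(X,X)`. -/
def envMap {X : Type*} [TopologicalSpace X] (T : X ≃ₜ X) : C(X, X) → C(X, X) :=
  fun φ => (T : C(X, X)).comp φ

theorem hzpow_ofNat_apply {X : Type*} [TopologicalSpace X] (T : X ≃ₜ X) (n : ℕ) (x : X) :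
    hzpow T (n : ℤ) x = T^[n] x := by
  change ((fun S : X ≃ₜ X => S.trans T)^[n] (Homeomorph.refl X)) x = T^[n] x
  induction n with
  | zero => rfl
  | succ k ih =>
    rw [Function.iterate_succ_apply', Function.iterate_succ_apply']
    simp [ih]

theorem envMap_iterate_apply {X : Type*} [TopologicalSpace X] (T : X ≃ₜ X) (n : ℕ)
    (φ : C(X, X)) (x : X) : ((envMap T)^[n] φ) x = T^[n] (φ x) := by
  induction n with
  | zero => rfl
  | succ k ih =>
    rw [Function.iterate_succ_apply', Function.iterate_succ_apply', ← ih]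
    rfl

theorem sepNum_bounded {X : Type*} [MetricSpace X] [CompactSpace X]
    (T : X ≃ₜ X) (heq : Equicontinuous (fun n : ℤ => ⇑(hzpow T n)))
    (K : Set C(X, X)) (hK : IsCompact K) (ε : ℝ) (hε : 0 < ε) :
    ∃ N : ℕ, ∀ n, sepNum (envMap T) n ε K ≤ N := by
  have hu := CompactSpace.uniformEquicontinuous_of_equicontinuous heq
  rw [Metric.uniformEquicontinuous_iff] at hu
  obtain ⟨δ, hδ, h⟩ := hu ε hε
  obtain ⟨t, -, ht, hcov⟩ := hK.finite_cover_balls (half_pos hδ)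
  refine ⟨ht.toFinset.card, fun n => csSup_le' ?_⟩
  rintro m ⟨E, hEK, hsep, rfl⟩
  have hc : ∀ φ ∈ E, ∃ ψ ∈ t, dist φ ψ < δ / 2 := by
    intro φ hφ
    have := hcov (hEK hφ)
    simpa using this
  choose! f hft hfd using hc
  refine Finset.card_le_card_of_injOn f (fun φ hφ => by simpa using hft φ hφ) ?_
  intro φ hφ ψ hψ hf
  by_contra hne
  obtain ⟨j, -, hj⟩ := hsep φ hφ ψ hψ hne
  have hd : dist φ ψ < δ := by
    have h1 := hfd φ hφ
    have h2 := hfd ψ hψ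
    have hf' : f φ = f ψ := hf
    rw [hf'] at h1
    have := dist_triangle_right φ ψ (f ψ)
    linarith
  refine absurd hj (not_lt.2 ((ContinuousMap.dist_le hε.le).2 fun x => ?_))
  rw [envMap_iterate_apply, envMap_iterate_apply, ← hzpow_ofNat_apply, ← hzpow_ofNat_apply]
  exact (h _ _ ((ContinuousMap.dist_apply_le_dist x).trans_lt hd) (j : ℤ)).le

theorem entropyOnSet_envMap_zero {X : Type*} [MetricSpace X] [CompactSpace X]
    (T : X ≃ₜ X) (heq : Equicontinuous (fun n : ℤ => ⇑(hzpow T n)))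
    (K : Set C(X, X)) (hK : IsCompact K) : entropyOnSet (envMap T) K = 0 := by
  have key : ∀ ε : ℝ, 0 < ε → Filter.atTop.limsup
      (fun n : ℕ => ((Real.log (sepNum (envMap T) n ε K) / n : ℝ) : EReal)) = 0 := by
    intro ε hε
    obtain ⟨N, hN⟩ := sepNum_bounded T heq K hK ε hε
    apply Tendsto.limsup_eq
    rw [← EReal.coe_zero]
    refine (continuous_coe_real_ereal.tendsto 0).comp ?_
    refine squeeze_zero (fun n => div_nonneg (Real.log_natCast_nonneg _) n.cast_nonneg)
      (fun n => ?_) (tendsto_const_div_atTop_nhds_zero_nat (Real.log N))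
    gcongr ?_ / _
    rcases Nat.eq_zero_or_pos (sepNum (envMap T) n ε K) with h0 | h0
    · rw [h0]
      simpa using Real.log_natCast_nonneg N
    · exact Real.log_le_log (by exact_mod_cast h0) (by exact_mod_cast hN n)
  unfold entropyOnSet
  apply le_antisymm
  · exact iSup₂_le fun ε hε => (key ε hε).le
  · exact (key 1 one_pos).ge.trans (le_iSup₂_of_le 1 one_pos le_rfl)

/-- If `T` is an equicontinuous homeomorphism of a compact zero-dimensional metric space, then
the topological entropy of the functional envelope `F_T` is zero both on `C(X,X)` and on
`H(X,X)`. -/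
theorem envelope_entropy_zero_of_equicontinuous {X : Type*} [MetricSpace X] [CompactSpace X]
    (hzd : ∀ x : X, ∀ U ∈ 𝓝 x, ∃ V : Set X, IsClopen V ∧ x ∈ V ∧ V ⊆ U)
    (T : X ≃ₜ X) (heq : Equicontinuous (fun n : ℤ => ⇑(hzpow T n))) :
    dynEntropy (envMap T) = 0 ∧ entropyOn (envMap T) (HSet X) = 0 := by
  have key := entropyOnSet_envMap_zero T heq
  constructor
  · apply le_antisymm
    · exact iSup₂_le fun K hK => (key K hK).le
    · exact (key ∅ isCompact_empty).ge.trans (le_iSup₂_of_le ∅ isCompact_empty le_rfl)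
  · apply le_antisymm
    · exact iSup₂_le fun K hK => iSup_le fun _ => (key K hK).le
    · exact (key ∅ isCompact_empty).ge.trans
        (le_iSup₂_of_le ∅ isCompact_empty (le_iSup_of_le (empty_subset _) le_rfl))
end

section
/- Let X be a compact zero-dimensional metric space and T : X → X a homeomorphism such that the family {T^n : n ∈ ℤ} is not equicontinuous. Then the topological entropy of F_T on H(X,X) is infinite (and hence so is the topological entropy of F_T on C(X,X)). -/
open Set Filter Topology

namespace EnvEnt

variable {X : Type*}

theorem hzpow_eq [TopologicalSpace X] (T : X ≃ₜ X) (n : ℤ) : hzpow T n = T ^ n := by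
  have h : ∀ k : ℕ, (fun S : X ≃ₜ X => S.trans T)^[k] (Homeomorph.refl X) = T ^ k := by
    intro k
    induction k with
    | zero => rfl
    | succ k ih => rw [Function.iterate_succ_apply', ih, pow_succ']; rfl
  cases n with
  | ofNat n => rw [hzpow, h]; simp
  | negSucc n => rw [hzpow, h, zpow_negSucc]; rfl

theorem coe_pow_eq [TopologicalSpace X] (T : X ≃ₜ X) (n : ℕ) : ⇑(T ^ n) = T^[n] := by
  induction n with
  | zero => rfl
  | succ k ih => rw [pow_succ', Function.iterate_succ', ← ih]; rfl

/-- Fine finite codes. -/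
theorem exists_code [MetricSpace X] [CompactSpace X]
    (hzd : ∀ x : X, ∀ U ∈ 𝓝 x, ∃ V : Set X, IsClopen V ∧ x ∈ V ∧ V ⊆ U)
    (δ : ℝ) (hδ : 0 < δ) :
    ∃ t : Finset X, ∃ e : X → (t → Prop), IsLocallyConstant e ∧
      ∀ x y, e x = e y → dist x y < δ := by
  choose V hV hxV hVs using fun x : X => hzd x (Metric.ball x (δ / 2))
    (Metric.ball_mem_nhds x (half_pos hδ))
  obtain ⟨t, ht⟩ := isCompact_univ.elim_finite_subcover V (fun x => (hV x).isOpen)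
    (fun x _ => mem_iUnion.2 ⟨x, hxV x⟩)
  refine ⟨t, fun y x => y ∈ V x, ?_, ?_⟩
  · rw [IsLocallyConstant.iff_eventually_eq]
    intro x
    have : ∀ i : t, ∀ᶠ y in 𝓝 x, (y ∈ V i) = (x ∈ V i) := by
      intro i
      by_cases hx : x ∈ V i
      · filter_upwards [(hV i).isOpen.mem_nhds hx] with y hy
        simp [hx, hy]
      · filter_upwards [(hV i).compl.isOpen.mem_nhds hx] with y hy
        have : y ∉ V i := hy
        simp [hx, this]
    filter_upwards [eventually_all.2 this] with y hy
    funext i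
    exact hy i
  · intro x y h
    have hx : x ∈ ⋃ i ∈ t, V i := ht (mem_univ x)
    simp only [mem_iUnion] at hx
    obtain ⟨i, hi, hxi⟩ := hx
    have := congrFun h ⟨i, hi⟩
    simp only [hxi, eq_iff_iff, true_iff] at this
    have h1 := hVs i hxi
    have h2 := hVs i this
    rw [Metric.mem_ball] at h1 h2
    linarith [dist_triangle_right x y i]

theorem exists_sep_const [MetricSpace X] [CompactSpace X] {ι : Type*} {c : X → ι}
    (hc : IsLocallyConstant c) : ∃ ε > 0, ∀ x y, c x ≠ c y → ε < dist x y := by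
  obtain ⟨δ, hδ, h⟩ := lebesgue_number_lemma_of_metric (isCompact_univ (X := X))
    (c := fun i : ι => {x | c x = i}) (fun i => hc.isOpen_fiber i)
    (fun x _ => mem_iUnion.2 ⟨c x, rfl⟩)
  refine ⟨δ / 2, half_pos hδ, fun x y hxy => ?_⟩
  by_contra hcon
  obtain ⟨i, hi⟩ := h x (mem_univ x)
  have h1 : c x = i := hi (Metric.mem_ball_self hδ)
  have h2 : c y = i := hi (by rw [Metric.mem_ball, dist_comm]; linarith)
  exact hxy (h1.trans h2.symm)

theorem lc_iter [TopologicalSpace X] {ι : Type*} {c : X → ι} (hc : IsLocallyConstant c)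
    (T : X ≃ₜ X) (n : ℕ) : IsLocallyConstant (fun x => c (T^[n] x)) :=
  hc.comp_continuous (T.continuous.iterate n)

theorem lc_pi [TopologicalSpace X] {ι α : Type*} [Finite α] {c : α → X → ι}
    (hc : ∀ a, IsLocallyConstant (c a)) : IsLocallyConstant (fun x a => c a x) := by
  rw [IsLocallyConstant.iff_eventually_eq]
  intro x
  filter_upwards [eventually_all.2 fun a => (hc a).eventually_eq x] with y hy
  funext a
  exact hy a

/-- If same-orbit pairs with the same `e`-code never separate, codes are periodic. -/
theorem periodic_of [TopologicalSpace X] {ι κ : Type*} [Finite κ] (T : X ≃ₜ X) (c : X → ι)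
    (e : X → κ)
    (h : ∀ x (m N : ℕ), e x = e (T^[m] x) → c (T^[N] x) = c (T^[N + m] x)) :
    ∃ M : ℕ, 0 < M ∧ ∀ x, c x = c (T^[M] x) := by
  have := Fintype.ofFinite κ
  set K := Fintype.card κ
  refine ⟨K.factorial, Nat.factorial_pos _, fun x => ?_⟩
  obtain ⟨y, rfl⟩ := (T.surjective.iterate K) x
  obtain ⟨i, j, hij, hj, he⟩ : ∃ i j : ℕ, i < j ∧ j ≤ K ∧ e (T^[i] y) = e (T^[j] y) := by
    obtain ⟨a, b, hab, heq⟩ := Fintype.exists_ne_map_eq_of_card_lt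
      (fun i : Fin (K + 1) => e (T^[i] y)) (by simp [K])
    rcases lt_or_gt_of_ne hab with hlt | hlt
    · exact ⟨a, b, hlt, by omega, heq⟩
    · exact ⟨b, a, hlt, by omega, heq.symm⟩
  obtain ⟨m, rfl⟩ := Nat.exists_eq_add_of_lt hij
  have hstep : ∀ q k : ℕ, c (T^[k] (T^[i] y)) = c (T^[k + q * (m + 1)] (T^[i] y)) := by
    intro q
    induction q with
    | zero => intro k; simp
    | succ q ih =>
      intro k
      rw [ih k, h (T^[i] y) (m + 1) (k + q * (m + 1))]
      · congr 2; ring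
      · rw [he, ← Function.iterate_add_apply]; congr 2; ring
  have hdvd : (m + 1) ∣ K.factorial := Nat.dvd_factorial (by omega) (by omega)
  obtain ⟨q, hq⟩ := hdvd
  have := hstep q (K - i)
  rw [← Function.iterate_add_apply, ← Function.iterate_add_apply] at this
  rw [← Function.iterate_add_apply, hq]
  have e1 : K - i + i = K := by omega
  have e2 : K - i + q * (m + 1) + i = (m + 1) * q + K := by rw [mul_comm (m + 1) q]; omega
  rw [e1, e2] at this
  exact this

theorem exists_bad_pair [MetricSpace X] {ι κ : Type*} [Finite κ] (T : X ≃ₜ X) (c : X → ι)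
    (hc : IsLocallyConstant c)
    (hbad : ¬ ∀ x, ∀ᶠ y in 𝓝 x, ∀ n : ℤ, c ((T ^ n) y) = c ((T ^ n) x))
    (e : X → κ) :
    ∃ x, ∃ m N : ℕ, e x = e (T^[m] x) ∧ c (T^[N] x) ≠ c (T^[N + m] x) := by
  by_contra hcon
  push Not at hcon
  obtain ⟨M, hM, hper⟩ := periodic_of T c e hcon
  apply hbad
  have hnat : ∀ k : ℕ, ∀ x, c (((T ^ M) ^ k) x) = c x := by
    intro k
    induction k with
    | zero => intro x; rfl
    | succ k ih =>
      intro x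
      rw [pow_succ', Homeomorph.mul_apply, coe_pow_eq, ← hper, ih]
  have hint : ∀ k : ℤ, ∀ x, c (((T ^ M) ^ k) x) = c x := by
    intro k x
    obtain ⟨k, rfl | rfl⟩ := k.eq_nat_or_neg
    · rw [zpow_natCast]; exact hnat k x
    · rw [← hnat k, ← Homeomorph.mul_apply, ← zpow_natCast, ← zpow_add]; simp
  have key : ∀ n : ℤ, ∃ r : Fin M, ∀ x, c ((T ^ n) x) = c (T^[r] x) := by
    intro n
    have hM' : (M : ℤ) ≠ 0 := by omega
    have h0 := Int.emod_nonneg n hM'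
    have h1 := Int.emod_lt_of_pos n (show (0 : ℤ) < M by omega)
    refine ⟨⟨(n % M).toNat, by omega⟩, fun x => ?_⟩
    have : T ^ n = (T ^ M) ^ (n / M) * T ^ (n % M).toNat := by
      rw [← zpow_natCast T M, ← zpow_mul, ← zpow_natCast T (n % M).toNat, ← zpow_add,
        Int.toNat_of_nonneg h0, Int.mul_ediv_add_emod]
    rw [this, Homeomorph.mul_apply, hint, coe_pow_eq]
  intro x
  filter_upwards [eventually_all.2 fun r : Fin M => (lc_iter hc T r).eventually_eq x] with y hy n
  obtain ⟨r, hr⟩ := key n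
  rw [hr, hr]
  exact hy r

/-- Either isolated points have linear complexity, or they are determined by a finite window. -/
theorem isolated_words {ι : Type*} (S : X → X) (c : X → ι) (I : Set X)
    (h : ∀ k : ℕ, ∃ x ∈ I, ∃ y ∈ I, (∀ j < k, c (S^[j] x) = c (S^[j] y)) ∧
      c (S^[k] x) ≠ c (S^[k] y)) (n : ℕ) :
    ∃ E : Finset X, ↑E ⊆ I ∧ E.card = n ∧
      ∀ x ∈ E, ∀ y ∈ E, x ≠ y → ∃ j < n, c (S^[j] x) ≠ c (S^[j] y) := by
  classical
  induction n with
  | zero => exact ⟨∅, by simp, rfl, by simp⟩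
  | succ k ih =>
    obtain ⟨E, hEI, hcard, hE⟩ := ih
    obtain ⟨x, hx, y, hy, hxy, hk⟩ := h k
    obtain ⟨w, hw, hwE⟩ : ∃ w ∈ I, ∀ z ∈ E, ∃ j < k + 1, c (S^[j] w) ≠ c (S^[j] z) := by
      by_cases hz : ∃ z ∈ E, ∀ j < k, c (S^[j] x) = c (S^[j] z)
      · obtain ⟨z, hzE, hz⟩ := hz
        obtain ⟨w, hw, hwk, hwz⟩ : ∃ w ∈ I, c (S^[k] w) ≠ c (S^[k] z) ∧
            ∀ j < k, c (S^[j] w) = c (S^[j] z) := by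
          by_cases hxz : c (S^[k] x) = c (S^[k] z)
          · exact ⟨y, hy, fun hh => hk (hxz.trans hh.symm),
              fun j hj => (hxy j hj).symm.trans (hz j hj)⟩
          · exact ⟨x, hx, hxz, hz⟩
        refine ⟨w, hw, fun z' hz' => ?_⟩
        by_cases hzz : z = z'
        · subst hzz; exact ⟨k, by omega, hwk⟩
        · obtain ⟨j, hj, hne⟩ := hE z hzE z' hz' hzz
          exact ⟨j, by omega, by rw [hwz j hj]; exact hne⟩
      · push Not at hz
        refine ⟨x, hx, fun z hzE => ?_⟩
        obtain ⟨j, hj, hne⟩ := hz z hzE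
        exact ⟨j, by omega, hne⟩
    have hwn : w ∉ E := fun hh => by
      obtain ⟨j, _, hne⟩ := hwE w hh
      exact hne rfl
    refine ⟨insert w E, ?_, by rw [Finset.card_insert_of_notMem hwn, hcard], ?_⟩
    · rw [Finset.coe_insert]; exact insert_subset hw hEI
    · intro a ha b hb hab
      rw [Finset.mem_insert] at ha hb
      rcases ha with rfl | ha <;> rcases hb with rfl | hb
      · exact absurd rfl hab
      · exact hwE b hb
      · obtain ⟨j, hj, hne⟩ := hwE a ha
        exact ⟨j, hj, hne.symm⟩
      · obtain ⟨j, hj, hne⟩ := hE a ha b hb hab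
        exact ⟨j, by omega, hne⟩

open Classical in
/-- Swap of a clopen set with its image. -/
noncomputable def swapFun [TopologicalSpace X] (g : X ≃ₜ X) (W : Set X) (x : X) : X :=
  if x ∈ W then g x else if g.symm x ∈ W then g.symm x else x

theorem swapFun_cont [TopologicalSpace X] (g : X ≃ₜ X) (W : Set X) (hW : IsClopen W) :
    Continuous (swapFun g W) := by
  classical
  have hW' : IsClopen {x | g.symm x ∈ W} := hW.preimage g.symm.continuous
  have h1 : Continuous fun x => if g.symm x ∈ W then g.symm x else x := by
    refine continuous_if (p := fun x => g.symm x ∈ W) ?_ g.symm.continuous.continuousOn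
      continuous_id.continuousOn
    rw [hW'.frontier_eq]; simp
  unfold swapFun
  refine continuous_if (p := fun x => x ∈ W) ?_ g.continuous.continuousOn h1.continuousOn
  have : {x | x ∈ W} = W := rfl
  rw [this, hW.frontier_eq]; simp

theorem swapFun_invol [TopologicalSpace X] (g : X ≃ₜ X) (W : Set X)
    (hd : ∀ x ∈ W, g x ∉ W) : Function.Involutive (swapFun g W) := by
  intro x
  unfold swapFun
  by_cases h1 : x ∈ W
  · simp [h1, hd x h1]
  · by_cases h2 : g.symm x ∈ W
    · simp [h1, h2]
    · simp [h1, h2]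

theorem clopen_infinite [MetricSpace X]
    (hzd : ∀ x : X, ∀ U ∈ 𝓝 x, ∃ V : Set X, IsClopen V ∧ x ∈ V ∧ V ⊆ U)
    (x : X) (hx : ¬ IsOpen ({x} : Set X)) (U : Set X) (hU : U ∈ 𝓝 x) :
    {W : Set X | IsClopen W ∧ W ⊆ U}.Infinite := by
  intro hfin
  apply hx
  have hfin' : {W : Set X | (IsClopen W ∧ W ⊆ U) ∧ x ∈ W}.Finite := hfin.subset fun W h => h.1
  have hop : IsOpen (⋂₀ {W : Set X | (IsClopen W ∧ W ⊆ U) ∧ x ∈ W}) :=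
    hfin'.isOpen_sInter fun W h => h.1.1.isOpen
  convert hop
  symm
  apply Subset.antisymm
  · intro y hy
    by_contra hne
    have hne' : x ≠ y := fun h => hne h.symm
    obtain ⟨V, hV, hxV, hVs⟩ := hzd x (U ∩ {y}ᶜ) (inter_mem hU (isOpen_ne.mem_nhds hne'))
    have := hy V ⟨⟨hV, fun z hz => (hVs hz).1⟩, hxV⟩
    exact (hVs this).2 rfl
  · rintro y rfl
    exact fun W hW => hW.2

theorem family_nonisolated [MetricSpace X] [CompactSpace X] {ι κ : Type*}
    (hzd : ∀ x : X, ∀ U ∈ 𝓝 x, ∃ V : Set X, IsClopen V ∧ x ∈ V ∧ V ⊆ U)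
    (T : X ≃ₜ X) (c : X → ι) (hc : IsLocallyConstant c) (e : X → κ) (he : IsLocallyConstant e)
    (x : X) (hx : ¬ IsOpen ({x} : Set X)) (m N : ℕ) (hex : e x = e (T^[m] x))
    (hcx : c (T^[N] x) ≠ c (T^[N + m] x)) (M : ℕ) :
    ∃ Φ : Finset C(X, X), (∀ φ ∈ Φ, IsHomeomorph φ ∧ ∀ x, e (φ x) = e x) ∧
      (∀ φ ∈ Φ, ∀ ψ ∈ Φ, φ ≠ ψ → ∃ j < N + 1, ∃ x, c (T^[j] (φ x)) ≠ c (T^[j] (ψ x))) ∧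
      Φ.card = M := by
  classical
  set g : X ≃ₜ X := T ^ m with hg
  have hgc : ⇑g = T^[m] := coe_pow_eq T m
  let U : Set X := {y | (e y = e x ∧ e (T^[m] y) = e x) ∧
    c (T^[N] y) = c (T^[N] x) ∧ c (T^[N + m] y) = c (T^[N + m] x)}
  have hU : U ∈ 𝓝 x := by
    filter_upwards [he.eventually_eq x, (lc_iter he T m).eventually_eq x,
      (lc_iter hc T N).eventually_eq x, (lc_iter hc T (N + m)).eventually_eq x] with y h1 h2 h3 h4
    exact ⟨⟨h1, h2.trans hex.symm⟩, h3, h4⟩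
  have hsep : ∀ y ∈ U, c (T^[N] y) ≠ c (T^[N] (g y)) := by
    intro y hy
    rw [hgc, ← Function.iterate_add_apply, hy.2.1, hy.2.2]
    exact hcx
  have hdis : ∀ y ∈ U, g y ∉ U := by
    intro y hy hgy
    exact hsep y hy (hy.2.1.trans hgy.2.1.symm)
  obtain ⟨F, hF, hFc⟩ := (clopen_infinite hzd x hx U hU).exists_subset_card_eq M
  have hF' : ∀ W ∈ F, IsClopen W ∧ W ⊆ U := fun W hW => hF hW
  let Ψ : F → C(X, X) := fun W => ⟨swapFun g W.1, swapFun_cont g W.1 (hF' W.1 W.2).1⟩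
  have hΨ1 : ∀ W : F, ∀ y ∈ W.1, Ψ W y = g y := by
    intro W y hy
    change swapFun g W.1 y = _
    simp [swapFun, hy]
  have hΨ2 : ∀ W : F, ∀ y ∈ U, y ∉ W.1 → Ψ W y = y := by
    intro W y hyU hy
    change swapFun g W.1 y = _
    have : g.symm y ∉ W.1 := by
      intro h
      have := hdis _ ((hF' W.1 W.2).2 h)
      rw [g.apply_symm_apply] at this
      exact this hyU
    simp [swapFun, hy, this]
  have hmain : ∀ V W : F, V ≠ W → ∃ y, c (T^[N] (Ψ V y)) ≠ c (T^[N] (Ψ W y)) := by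
    intro V W hVW
    have hne : V.1 ≠ W.1 := fun h => hVW (Subtype.ext h)
    have : ∃ y, ¬ (y ∈ V.1 ↔ y ∈ W.1) := by
      by_contra hcon
      push Not at hcon
      exact hne (Set.ext hcon)
    obtain ⟨y, hy⟩ := this
    refine ⟨y, ?_⟩
    by_cases h1 : y ∈ V.1
    · have h2 : y ∉ W.1 := fun h => hy ⟨fun _ => h, fun _ => h1⟩
      have hyU := (hF' V.1 V.2).2 h1
      rw [hΨ1 V y h1, hΨ2 W y hyU h2]
      exact (hsep y hyU).symm
    · have h2 : y ∈ W.1 := by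
        by_contra h
        exact hy ⟨fun h' => absurd h' h1, fun h' => absurd h' h⟩
      have hyU := (hF' W.1 W.2).2 h2
      rw [hΨ1 W y h2, hΨ2 V y hyU h1]
      exact hsep y hyU
  have hinj : Function.Injective Ψ := by
    intro V W h
    by_contra hne
    obtain ⟨y, hy⟩ := hmain V W hne
    rw [h] at hy
    exact hy rfl
  refine ⟨Finset.univ.image Ψ, ?_, ?_, ?_⟩
  · intro φ hφ
    simp only [Finset.mem_image, Finset.mem_univ, true_and] at hφ
    obtain ⟨W, rfl⟩ := hφ
    have hWU := (hF' W.1 W.2).2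
    refine ⟨isHomeomorph_iff_continuous_bijective.2 ⟨(Ψ W).continuous, ?_⟩, ?_⟩
    · exact (swapFun_invol g W.1 fun y hy h => hdis y (hWU hy) (hWU h)).bijective
    · intro y
      change e (swapFun g W.1 y) = e y
      unfold swapFun
      split_ifs with h1 h2
      · have := (hWU h1).1
        rw [hgc, this.1, this.2]
      · have := (hWU h2).1
        rw [← hgc, g.apply_symm_apply] at this
        rw [this.1, this.2]
      · rfl
  · intro φ hφ ψ hψ hne
    simp only [Finset.mem_image, Finset.mem_univ, true_and] at hφ hψ
    obtain ⟨V, rfl⟩ := hφ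
    obtain ⟨W, rfl⟩ := hψ
    obtain ⟨y, hy⟩ := hmain V W (fun h => hne (by rw [h]))
    exact ⟨N, by omega, y, hy⟩
  · rw [Finset.card_image_of_injective _ hinj]
    simpa using hFc

theorem perm_cont [MetricSpace X] (E : Finset X) (hE : ∀ x ∈ E, IsOpen ({x} : Set X))
    (f : X → X) (hf : ∀ x ∉ E, f x = x) : Continuous f := by
  rw [continuous_iff_continuousAt]
  intro x
  by_cases hx : x ∈ E
  · have : 𝓝 x = pure x := (isOpen_singleton_iff_nhds_eq_pure x).1 (hE x hx)
    rw [ContinuousAt, this]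
    exact tendsto_pure_left.2 fun s hs => mem_of_mem_nhds hs
  · have hop : IsOpen ((E : Set X)ᶜ) := E.finite_toSet.isClosed.isOpen_compl
    refine continuousAt_id.congr ?_
    filter_upwards [hop.mem_nhds hx] with y hy
    exact (hf y hy).symm

theorem family_isolated [MetricSpace X] [CompactSpace X] {ι κ : Type*}
    (T : X ≃ₜ X) (c : X → ι) (e : X → κ) (E : Finset X) (hE : ∀ x ∈ E, IsOpen ({x} : Set X))
    (heE : ∀ x ∈ E, ∀ y ∈ E, e x = e y) (N : ℕ)
    (hsep : ∀ x ∈ E, ∀ y ∈ E, x ≠ y → ∃ j < N, c (T^[j] x) ≠ c (T^[j] y)) :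
    ∃ Φ : Finset C(X, X), (∀ φ ∈ Φ, IsHomeomorph φ ∧ ∀ x, e (φ x) = e x) ∧
      (∀ φ ∈ Φ, ∀ ψ ∈ Φ, φ ≠ ψ → ∃ j < N, ∃ x, c (T^[j] (φ x)) ≠ c (T^[j] (ψ x))) ∧
      Φ.card = E.card.factorial := by
  classical
  have hout : ∀ σ : Equiv.Perm E, ∀ x ∉ E, Equiv.Perm.ofSubtype σ x = x := fun σ x hx =>
    Equiv.Perm.ofSubtype_apply_of_not_mem σ hx
  have hin : ∀ σ : Equiv.Perm E, ∀ x : E, Equiv.Perm.ofSubtype σ (x : X) = σ x := fun σ x =>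
    Equiv.Perm.ofSubtype_apply_coe σ x
  let Ψ : Equiv.Perm E → C(X, X) := fun σ =>
    ⟨Equiv.Perm.ofSubtype σ, perm_cont E hE _ (hout σ)⟩
  have hΨ : ∀ σ : Equiv.Perm E, ∀ x : E, Ψ σ (x : X) = σ x := hin
  have hmain : ∀ σ τ : Equiv.Perm E, σ ≠ τ → ∃ j < N, ∃ y,
      c (T^[j] (Ψ σ y)) ≠ c (T^[j] (Ψ τ y)) := by
    intro σ τ h
    obtain ⟨y, hy⟩ : ∃ y, σ y ≠ τ y := by
      by_contra hcon
      push Not at hcon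
      exact h (Equiv.ext hcon)
    obtain ⟨j, hj, hne⟩ := hsep _ (σ y).2 _ (τ y).2 (fun h => hy (Subtype.ext h))
    exact ⟨j, hj, y, by rw [hΨ, hΨ]; exact hne⟩
  have hinj : Function.Injective Ψ := by
    intro V W h
    by_contra hne
    obtain ⟨j, _, y, hy⟩ := hmain V W hne
    rw [h] at hy
    exact hy rfl
  refine ⟨Finset.univ.image Ψ, ?_, ?_, ?_⟩
  · intro φ hφ
    simp only [Finset.mem_image, Finset.mem_univ, true_and] at hφ
    obtain ⟨σ, rfl⟩ := hφ
    refine ⟨isHomeomorph_iff_continuous_bijective.2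
      ⟨(Ψ σ).continuous, (Equiv.Perm.ofSubtype σ).bijective⟩, ?_⟩
    intro y
    by_cases hy : y ∈ E
    · have := hΨ σ ⟨y, hy⟩
      rw [this]
      exact heE _ (σ _).2 _ hy
    · exact congrArg e (hout σ y hy)
  · intro φ hφ ψ hψ hne
    simp only [Finset.mem_image, Finset.mem_univ, true_and] at hφ hψ
    obtain ⟨V, rfl⟩ := hφ
    obtain ⟨W, rfl⟩ := hψ
    exact hmain V W (fun h => hne (by rw [h]))
  · rw [Finset.card_image_of_injective _ hinj, Finset.card_univ, Fintype.card_perm]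
    simp

theorem family [MetricSpace X] [CompactSpace X] {ι κ : Type*} [Finite ι] [Finite κ]
    (hzd : ∀ x : X, ∀ U ∈ 𝓝 x, ∃ V : Set X, IsClopen V ∧ x ∈ V ∧ V ⊆ U)
    (T : X ≃ₜ X) (c : X → ι) (hc : IsLocallyConstant c)
    (hbad : ¬ ∀ x, ∀ᶠ y in 𝓝 x, ∀ n : ℤ, c ((T ^ n) y) = c ((T ^ n) x))
    (e : X → κ) (he : IsLocallyConstant e) (R : ℕ) :
    ∃ N : ℕ, ∃ Φ : Finset C(X, X), (∀ φ ∈ Φ, IsHomeomorph φ ∧ ∀ x, e (φ x) = e x) ∧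
      (∀ φ ∈ Φ, ∀ ψ ∈ Φ, φ ≠ ψ → ∃ j < N, ∃ x, c (T^[j] (φ x)) ≠ c (T^[j] (ψ x))) ∧
      (R + 2) ^ (N + 1) ≤ Φ.card := by
  classical
  let I : Set X := {x | IsOpen ({x} : Set X)}
  have hTI : ∀ n : ℕ, ∀ x ∈ I, T^[n] x ∈ I := by
    intro n x hx
    have : IsOpen ((T ^ n : X ≃ₜ X) '' {x}) := (T ^ n : X ≃ₜ X).isOpenMap _ hx
    rw [image_singleton, coe_pow_eq] at this
    exact this
  by_cases h : ∀ k : ℕ, ∃ x ∈ I, ∃ y ∈ I, (∀ j < k, c (T^[j] x) = c (T^[j] y)) ∧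
      c (T^[k] x) ≠ c (T^[k] y)
  · have hiso := isolated_words T c I h
    have := Fintype.ofFinite κ
    set p := Fintype.card κ with hp
    have hpne : Nonempty κ := ⟨e (h 0).choose⟩
    obtain ⟨L, hL⟩ : ∃ L : ℕ, (R + 2) ^ (p * L + 1) ≤ L.factorial := by
      have ht := FloorSemiring.tendsto_pow_div_factorial_atTop (((R : ℝ) + 2) ^ p)
      have hpos : (0 : ℝ) < 1 / (R + 2) := by positivity
      obtain ⟨L, hL⟩ := (ht.eventually (gt_mem_nhds hpos)).exists
      refine ⟨L, ?_⟩
      rw [div_lt_div_iff₀ (by positivity) (by positivity), ← pow_mul, ← pow_succ, one_mul] at hL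
      exact_mod_cast hL.le
    obtain ⟨E, hEI, hEc, hEs⟩ := hiso (p * L)
    obtain ⟨k, -, hk⟩ := Finset.exists_le_card_fiber_of_mul_le_card_of_maps_to (s := E)
      (t := Finset.univ) (f := e) (n := L) (fun _ _ => Finset.mem_univ _)
      Finset.univ_nonempty (by rw [Finset.card_univ, hEc])
    obtain ⟨E', hE', hcard⟩ := Finset.exists_subset_card_eq hk
    have hm : ∀ x ∈ E', x ∈ E ∧ e x = k := fun x hx => Finset.mem_filter.1 (hE' hx)
    obtain ⟨Φ, h1, h2, h3⟩ := family_isolated T c e E' (fun x hx => hEI (hm x hx).1)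
      (fun x hx y hy => (hm x hx).2.trans (hm y hy).2.symm) (p * L)
      (fun x hx y hy => hEs x (hm x hx).1 y (hm y hy).1)
    exact ⟨p * L, Φ, h1, h2, by rw [h3, hcard]; exact hL⟩
  · push Not at h
    obtain ⟨k, hk⟩ := h
    have hall : ∀ j : ℕ, ∀ x ∈ I, ∀ y ∈ I, (∀ j < k, c (T^[j] x) = c (T^[j] y)) →
        c (T^[j] x) = c (T^[j] y) := by
      intro j
      induction j using Nat.strong_induction_on with
      | _ j ih =>
        intro x hx y hy hxy
        by_cases hj : j < k
        · exact hxy j hj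
        · have := hk _ (hTI (j - k) x hx) _ (hTI (j - k) y hy) (fun i hi => by
            rw [← Function.iterate_add_apply, ← Function.iterate_add_apply]
            exact ih _ (by omega) x hx y hy hxy)
          rw [← Function.iterate_add_apply, ← Function.iterate_add_apply] at this
          rwa [show k + (j - k) = j by omega] at this
    obtain ⟨x, m, N, hex, hne⟩ := exists_bad_pair T c hc hbad
      (fun x => (e x, fun j : Fin k => c (T^[j] x)))
    rw [Prod.mk.injEq] at hex
    have hxI : x ∉ I := by
      intro hx
      apply hne
      rw [Function.iterate_add_apply]
      exact hall N x hx _ (hTI m x hx) fun j hj => congrFun hex.2 ⟨j, hj⟩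
    obtain ⟨Φ, h1, h2, h3⟩ := family_nonisolated hzd T c hc e he x hxI m N hex.1 hne
      ((R + 2) ^ (N + 1 + 1))
    exact ⟨N + 1, Φ, h1, h2, h3.ge⟩

theorem sepNum_ge {Z : Type*} [PseudoMetricSpace Z] (S : Z → Z) (hS : Continuous S) (n : ℕ)
    (ε : ℝ) (hε : 0 < ε) (K : Set Z) (hK : IsCompact K) (E : Finset Z) (hEK : ↑E ⊆ K)
    (hE : IsDynSep S n ε ↑E) : E.card ≤ sepNum S n ε K := by
  classical
  refine le_csSup ?_ ⟨E, hEK, hE, rfl⟩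
  let V : Z → Set Z := fun x => {y | ∀ j : Fin n, dist (S^[j] y) (S^[j] x) < ε / 2}
  have hV : ∀ x, V x ∈ 𝓝 x := by
    intro x
    refine eventually_all.2 fun j => ?_
    exact (hS.iterate j).continuousAt.eventually (Metric.ball_mem_nhds _ (half_pos hε))
  obtain ⟨t, -, ht⟩ := hK.elim_nhds_subcover V fun x _ => hV x
  refine ⟨t.card, ?_⟩
  rintro _ ⟨F, hFK, hF, rfl⟩
  have : ∀ x ∈ F, ∃ z ∈ t, x ∈ V z := by
    intro x hx
    have := ht (hFK hx)
    simp only [mem_iUnion, exists_prop] at this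
    exact this
  choose! f hf1 hf2 using this
  refine Finset.card_le_card_of_injOn f hf1 ?_
  intro x hx y hy hxy
  by_contra hne
  obtain ⟨j, hj, hd⟩ := hF x hx y hy hne
  have h1 := hf2 x hx ⟨j, hj⟩
  have h2 := hf2 y hy ⟨j, hj⟩
  rw [← hxy] at h2
  have := dist_triangle_right (S^[j] x) (S^[j] y) (S^[j] (f x))
  simp only at h1 h2
  linarith

theorem env_iter [TopologicalSpace X] (T : X ≃ₜ X) (j : ℕ) (φ : C(X, X)) (x : X) :
    ((envMap T)^[j] φ) x = T^[j] (φ x) := by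
  induction j with
  | zero => rfl
  | succ j ih =>
    rw [Function.iterate_succ_apply', Function.iterate_succ_apply', ← ih]
    rfl

theorem exists_compact [MetricSpace X] [CompactSpace X]
    (hzd : ∀ x : X, ∀ U ∈ 𝓝 x, ∃ V : Set X, IsClopen V ∧ x ∈ V ∧ V ⊆ U)
    (T : X ≃ₜ X) (hneq : ¬ Equicontinuous (fun n : ℤ => ⇑(hzpow T n))) :
    ∃ K : Set C(X, X), IsCompact K ∧ K ⊆ HSet X ∧ entropyOnSet (envMap T) K = ⊤ := by
  classical
  -- the code witnessing non-equicontinuity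
  obtain ⟨ε₁, hε₁, hne⟩ : ∃ ε > 0, ¬ ∀ x, ∀ᶠ y in 𝓝 x, ∀ n : ℤ,
      dist ((T ^ n) x) ((T ^ n) y) < ε := by
    by_contra hcon
    push Not at hcon
    apply hneq
    intro x
    rw [Metric.equicontinuousAt_iff_right]
    intro ε hε
    simp only [hzpow_eq]
    exact hcon ε hε x
  obtain ⟨t, c, hc, hct⟩ := exists_code hzd ε₁ hε₁
  have hbad : ¬ ∀ x, ∀ᶠ y in 𝓝 x, ∀ n : ℤ, c ((T ^ n) y) = c ((T ^ n) x) := by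
    intro h
    apply hne
    intro x
    filter_upwards [h x] with y hy n
    exact hct _ _ (hy n).symm
  obtain ⟨ε, hε, hcε⟩ := exists_sep_const hc
  -- families
  have hfam : ∀ k : ℕ, ∃ N : ℕ, ∃ Φ : Finset C(X, X),
      (∀ φ ∈ Φ, IsHomeomorph φ ∧ dist φ (ContinuousMap.id X) ≤ 1 / ((k : ℝ) + 1)) ∧
      IsDynSep (envMap T) N ε (Φ : Set C(X, X)) ∧ k < N ∧ (k + 2) ^ (N + 1) ≤ Φ.card := by
    intro k
    have hk : (0 : ℝ) < 1 / ((k : ℝ) + 1) := by positivity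
    obtain ⟨s, d, hd, hds⟩ := exists_code hzd _ hk
    obtain ⟨N, Φ, h1, h2, h3⟩ := family hzd T c hc hbad
      (fun x => (d x, fun j : Fin (k + 1) => c (T^[j] x)))
      (hd.prodMk (lc_pi fun j : Fin (k + 1) => lc_iter hc T j)) k
    refine ⟨N, Φ, ?_, ?_, ?_, h3⟩
    · intro φ hφ
      refine ⟨(h1 φ hφ).1, ?_⟩
      rw [ContinuousMap.dist_le hk.le]
      intro x
      have := (h1 φ hφ).2 x
      rw [Prod.mk.injEq] at this
      exact (hds _ _ this.1).le
    · intro φ hφ ψ hψ hne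
      obtain ⟨j, hj, x, hx⟩ := h2 φ hφ ψ hψ hne
      refine ⟨j, hj, (hcε _ _ hx).trans_le ?_⟩
      rw [← env_iter, ← env_iter]
      exact ContinuousMap.dist_apply_le_dist x
    · have hc1 : 1 < Φ.card := lt_of_lt_of_le (Nat.one_lt_pow (by omega) (by omega)) h3
      obtain ⟨φ, hφ, ψ, hψ, hne⟩ := Finset.one_lt_card.1 hc1
      obtain ⟨j, hj, x, hx⟩ := h2 φ hφ ψ hψ hne
      by_contra hNk
      apply hx
      have a1 := (h1 φ hφ).2 x
      have a2 := (h1 ψ hψ).2 x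
      rw [Prod.mk.injEq] at a1 a2
      have b1 := congrFun a1.2 ⟨j, by omega⟩
      have b2 := congrFun a2.2 ⟨j, by omega⟩
      exact b1.trans b2.symm
  choose N Φ hΦ hsep hkN hcard using hfam
  let f : (Σ k : ℕ, Φ k) → C(X, X) := fun q => q.2.1
  have hf : Tendsto f cofinite (𝓝 (ContinuousMap.id X)) := by
    rw [Metric.tendsto_nhds]
    intro η hη
    obtain ⟨k₀, hk₀⟩ := exists_nat_one_div_lt hη
    rw [eventually_cofinite]
    refine Set.Finite.subset (s := ⋃ k ∈ Set.Iio k₀, range fun φ : Φ k =>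
      (⟨k, φ⟩ : Σ k : ℕ, Φ k)) ?_ ?_
    · exact (Set.finite_Iio k₀).biUnion fun k _ => Set.finite_range _
    · rintro ⟨k, φ⟩ hq
      simp only [mem_iUnion]
      refine ⟨k, ?_, φ, rfl⟩
      by_contra hk
      apply hq
      have hk' : k₀ ≤ k := by simpa using hk
      have hle : 1 / ((k : ℝ) + 1) ≤ 1 / ((k₀ : ℝ) + 1) := by gcongr
      exact ((hΦ k φ.1 φ.2).2.trans hle).trans_lt hk₀
  have hKc := hf.isCompact_insert_range_of_cofinite
  set K := insert (ContinuousMap.id X) (range f) with hK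
  refine ⟨K, hKc, ?_, ?_⟩
  · intro φ hφ
    rcases hφ with rfl | ⟨⟨k, φ⟩, rfl⟩
    · exact (Homeomorph.refl X).isHomeomorph
    · exact (hΦ k φ.1 φ.2).1
  · have hcont : Continuous (envMap T) := ContinuousMap.continuous_postcomp _
    have hle : ∀ k, (k + 2) ^ (N k + 1) ≤ sepNum (envMap T) (N k) ε K := by
      intro k
      refine (hcard k).trans (sepNum_ge _ hcont _ ε hε K hKc _ ?_ (hsep k))
      intro φ hφ
      exact Or.inr ⟨⟨k, φ, hφ⟩, rfl⟩
    have hlog : ∀ k : ℕ, Real.log ((k : ℝ) + 2) ≤ Real.log (sepNum (envMap T) (N k) ε K) / (N k) := by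
      intro k
      have hN : (0 : ℝ) < N k := by
        have := hkN k
        exact_mod_cast (by omega : 0 < N k)
      have h0 : 0 ≤ Real.log ((k : ℝ) + 2) := Real.log_nonneg (by linarith [k.cast_nonneg (α := ℝ)])
      have h1 : (((k : ℝ) + 2) ^ (N k + 1)) ≤ sepNum (envMap T) (N k) ε K := by
        exact_mod_cast hle k
      have h2 := Real.log_le_log (by positivity) h1
      rw [Real.log_pow] at h2
      push_cast at h2
      rw [le_div_iff₀ hN]
      nlinarith
    rw [EReal.eq_top_iff_forall_lt]
    intro a
    have hlt : (a : EReal) < ((a + 1 : ℝ) : EReal) := by exact_mod_cast lt_add_one a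
    refine hlt.trans_le ?_
    unfold entropyOnSet
    refine le_iSup₂_of_le ε hε ?_
    refine le_limsup_of_frequently_le' ?_
    rw [frequently_atTop]
    intro n
    have htend : Tendsto (fun k : ℕ => Real.log ((k : ℝ) + 2)) atTop atTop :=
      Real.tendsto_log_atTop.comp
        (tendsto_atTop_add_const_right _ _ tendsto_natCast_atTop_atTop)
    obtain ⟨k, hk1, hk2⟩ := ((htend.eventually_ge_atTop (a + 1)).and (eventually_ge_atTop n)).exists
    refine ⟨N k, hk2.trans (hkN k).le, ?_⟩
    exact_mod_cast hk1.trans (hlog k)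

end EnvEnt

/-- If `T` is a non-equicontinuous homeomorphism of a compact zero-dimensional metric space,
then the topological entropy of the functional envelope `F_T` on `H(X,X)` is infinite, and
hence so is its entropy on `C(X,X)`. -/
theorem envelope_entropy_top_of_not_equicontinuous {X : Type*} [MetricSpace X] [CompactSpace X]
    (hzd : ∀ x : X, ∀ U ∈ 𝓝 x, ∃ V : Set X, IsClopen V ∧ x ∈ V ∧ V ⊆ U)
    (T : X ≃ₜ X) (hneq : ¬ Equicontinuous (fun n : ℤ => ⇑(hzpow T n))) :
    entropyOn (envMap T) (HSet X) = ⊤ ∧ dynEntropy (envMap T) = ⊤ := by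
  obtain ⟨K, hK, hKH, htop⟩ := EnvEnt.exists_compact hzd T hneq
  constructor
  · refine top_le_iff.1 (htop.ge.trans ?_)
    exact le_iSup_of_le K (le_iSup_of_le hK (le_iSup_of_le hKH le_rfl))
  · refine top_le_iff.1 (htop.ge.trans ?_)
    exact le_iSup_of_le K (le_iSup_of_le hK le_rfl)
end

section
/- Let X be a homogeneous compact metric space. Then for each x ∈ X there exists a compact subset 𝓕 of H(X,X) (the group of self-homeomorphisms of X with the uniform metric) such that for every y ∈ X there is an f ∈ 𝓕 with f(x) = y. -/
open Set Filter Topology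

open scoped Pointwise

/-- The orbit maps of a transitive action of a Lindelof group on a Baire space are almost open. -/
theorem almost_open_one {G X : Type*} [Group G] [TopologicalSpace G] [IsTopologicalGroup G]
    [SecondCountableTopology G] [TopologicalSpace X] [BaireSpace X] [MulAction G X]
    [ContinuousSMul G X] [MulAction.IsPretransitive G X]
    {U : Set G} (hU : U ∈ 𝓝 1) (x : X) : closure (U • {x}) ∈ 𝓝 x := by
  obtain ⟨V, V_mem, V_closed, V_symm, VU⟩ : ∃ V ∈ 𝓝 (1 : G), IsClosed V ∧ V⁻¹ = V ∧ V * V ⊆ U :=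
    exists_closed_nhds_one_inv_eq_mul_subset hU
  obtain ⟨s, s_count, hs⟩ : ∃ (s : Set G), s.Countable ∧ ⋃ g ∈ s, g • V = univ :=
    TopologicalSpace.countable_cover_nhds fun g ↦ by simpa
  obtain ⟨⟨g, hg⟩, hi⟩ : ∃ i : s, (interior (closure (((i : G) • V) • ({x} : Set X)))).Nonempty := by
    have : Nonempty X := ⟨x⟩
    have : Countable s := s_count
    apply nonempty_interior_of_iUnion_of_closed
    · intro i
      exact isClosed_closure
    · apply eq_univ_iff_forall.2 (fun y ↦ ?_)
      obtain ⟨h, rfl⟩ : ∃ h : G, h • x = y := MulAction.exists_smul_eq G x y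
      obtain ⟨g, gs, hg⟩ : ∃ g ∈ s, h ∈ g • V := exists_set_mem_of_union_eq_top s _ hs _
      rw [mem_iUnion]
      exact ⟨⟨g, gs⟩, subset_closure (smul_mem_smul hg rfl)⟩
  obtain ⟨y, hy⟩ : (interior (closure (V • ({x} : Set X)))).Nonempty := by
    rw [smul_assoc, closure_smul, interior_smul] at hi
    exact smul_set_nonempty.1 hi
  obtain ⟨z, hz, hzV⟩ := mem_closure_iff.1 (interior_subset hy) _ isOpen_interior hy
  obtain ⟨g', hg', rfl⟩ : ∃ g' ∈ V, g' • x = z := by simpa using hzV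
  have J : closure ((g'⁻¹ • V) • {x}) ∈ 𝓝 x := by
    apply mem_interior_iff_mem_nhds.1
    rwa [smul_assoc, closure_smul, interior_smul, mem_inv_smul_set_iff]
  refine Filter.mem_of_superset J (closure_mono ?_)
  apply smul_subset_smul_right
  apply Subset.trans (smul_set_subset_smul (inv_mem_inv.2 hg')) ?_
  rw [V_symm]
  exact VU

theorem almost_open {G X : Type*} [Group G] [TopologicalSpace G] [IsTopologicalGroup G]
    [SecondCountableTopology G] [TopologicalSpace X] [BaireSpace X] [MulAction G X]
    [ContinuousSMul G X] [MulAction.IsPretransitive G X]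
    (g : G) {U : Set G} (hU : U ∈ 𝓝 g) (x : X) :
    closure ((fun g : G => g • x) '' U) ∈ 𝓝 (g • x) := by
  have : (fun g : G => g • x) = (· • (g • x)) ∘ (· * g⁻¹) := by
    ext g
    simp [smul_smul]
  rw [this, image_comp, ← smul_singleton]
  apply almost_open_one
  simpa using isOpenMap_mul_right g⁻¹ |>.image_mem_nhds hU

theorem effros_step {G X : Type*} [Group G] [MetricSpace G] [IsTopologicalGroup G]
    [SecondCountableTopology G] [MetricSpace X] [BaireSpace X] [MulAction G X]
    [ContinuousSMul G X] [MulAction.IsPretransitive G X]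
    (x y : X) (g h : G) (ε δ : ℝ) (hδ : 0 < δ)
    (H : h • y ∈ closure ((fun g : G => g • x) '' Metric.ball g ε)) :
    ∃ g' : G, dist g' g < ε ∧ g' • x ∈ closure ((fun g : G => g • y) '' Metric.ball h δ) ∧
      dist (g' • x) (h • y) < δ := by
  have h1 := almost_open h (Metric.ball_mem_nhds h hδ) y
  have h2 := Filter.inter_mem h1 (Metric.ball_mem_nhds (h • y) hδ)
  obtain ⟨z, ⟨hz1, hz2⟩, g', hg', rfl⟩ := mem_closure_iff_nhds.1 H _ h2
  exact ⟨g', hg', hz1, hz2⟩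

/-- The Effros theorem at the identity. -/
theorem effros_one {G X : Type*} [Group G] [MetricSpace G] [IsTopologicalGroup G]
    [CompleteSpace G]
    [SecondCountableTopology G] [MetricSpace X] [BaireSpace X] [MulAction G X]
    [ContinuousSMul G X] [MulAction.IsPretransitive G X]
    {U : Set G} (hU : U ∈ 𝓝 1) (x : X) : U • {x} ∈ 𝓝 x := by
  obtain ⟨c, hc, hcU⟩ : ∃ c > 0, ∀ g h : G, dist g 1 ≤ c → dist h 1 ≤ c → h⁻¹ * g ∈ U := by
    have hcont : Continuous (fun p : G × G => p.2⁻¹ * p.1) := by fun_prop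
    have h1 : (fun p : G × G => p.2⁻¹ * p.1) ⁻¹' U ∈ 𝓝 ((1 : G), (1 : G)) := by
      apply hcont.continuousAt
      simpa using hU
    obtain ⟨c, hc, h⟩ := Metric.nhds_basis_closedBall.mem_iff.1 h1
    refine ⟨c, hc, fun g k hg hk => ?_⟩
    have : (g, k) ∈ Metric.closedBall ((1 : G), (1 : G)) c := by
      simp [Prod.dist_eq, hg, hk]
    exact h this
  let ε : ℕ → ℝ := fun n => c / 2 / 2 ^ n
  have hε : ∀ n, 0 < ε n := fun n => by positivity
  refine Filter.mem_of_superset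
    (by simpa using almost_open (1 : G) (Metric.ball_mem_nhds 1 (hε 0)) x) ?_
  intro y hy
  let P : ℕ → G × G → Prop := fun n p =>
    p.2 • y ∈ closure ((fun g : G => g • x) '' Metric.ball p.1 (ε n))
  have step : ∀ n p, P n p → ∃ p' : G × G, P (n+1) p' ∧ dist p.1 p'.1 ≤ ε n ∧
      dist p.2 p'.2 ≤ ε n ∧ dist (p'.1 • x) (p'.2 • y) ≤ ε n := by
    rintro n ⟨g, h⟩ hP
    obtain ⟨g', h1, h2, h3⟩ := effros_step x y g h (ε n) (ε n) (hε n) hP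
    obtain ⟨h', k1, k2, k3⟩ := effros_step y x h g' (ε n) (ε (n+1)) (hε _) h2
    refine ⟨(g', h'), k2, by rw [dist_comm]; exact h1.le, by rw [dist_comm]; exact k1.le, ?_⟩
    rw [dist_comm]
    refine k3.le.trans ?_
    simp only [ε]
    gcongr <;> simp
  choose! f hf using step
  let s : ℕ → G × G := fun n => Nat.rec (1, 1) (fun n p => f n p) n
  have hs : ∀ n, s (n+1) = f n (s n) := fun n => rfl
  have hP : ∀ n, P n (s n) := by
    intro n
    induction n with
    | zero => simpa [P, s] using hy
    | succ n ih => rw [hs]; exact (hf n _ ih).1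
  have d1 : ∀ n, dist (s n).1 (s (n+1)).1 ≤ c / 2 / 2 ^ n := fun n => (hf n _ (hP n)).2.1
  have d2 : ∀ n, dist (s n).2 (s (n+1)).2 ≤ c / 2 / 2 ^ n := fun n => (hf n _ (hP n)).2.2.1
  have d3 : ∀ n, dist ((s (n+1)).1 • x) ((s (n+1)).2 • y) ≤ ε n :=
    fun n => (hf n _ (hP n)).2.2.2
  obtain ⟨g, hg⟩ := cauchySeq_tendsto_of_complete (cauchySeq_of_le_geometric_two d1)
  obtain ⟨h, hh⟩ := cauchySeq_tendsto_of_complete (cauchySeq_of_le_geometric_two d2)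
  have e1 := dist_le_of_le_geometric_two_of_tendsto₀ d1 hg
  have e2 := dist_le_of_le_geometric_two_of_tendsto₀ d2 hh
  have hε0 : Tendsto ε atTop (𝓝 0) := by
    have := (tendsto_pow_atTop_nhds_zero_of_lt_one (r := (1/2 : ℝ)) (by norm_num)
      (by norm_num)).const_mul (c / 2)
    simpa [ε, div_eq_mul_inv] using this
  have hgh : g • x = h • y := by
    have t1 := (hg.comp (tendsto_add_atTop_nat 1)).smul_const x
    have t2 := (hh.comp (tendsto_add_atTop_nat 1)).smul_const y
    have t3 := le_of_tendsto_of_tendsto' (t1.dist t2) hε0 d3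
    exact dist_le_zero.1 t3
  refine ⟨h⁻¹ * g, hcU g h (by rw [dist_comm]; exact e1) (by rw [dist_comm]; exact e2), x, rfl, ?_⟩
  simp [mul_smul, hgh]

/-- The Effros theorem. -/
theorem effros_open {G X : Type*} [Group G] [MetricSpace G] [IsTopologicalGroup G]
    [CompleteSpace G]
    [SecondCountableTopology G] [MetricSpace X] [BaireSpace X] [MulAction G X]
    [ContinuousSMul G X] [MulAction.IsPretransitive G X] (x : X) :
    IsOpenMap (fun (g : G) ↦ g • x) := by
  simp_rw [isOpenMap_iff_nhds_le, Filter.le_map_iff]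
  intro g U hU
  have : (fun g : G => g • x) = (· • (g • x)) ∘ (· * g⁻¹) := by
    ext g
    simp [smul_smul]
  rw [this, image_comp, ← smul_singleton]
  apply effros_one
  simpa using isOpenMap_mul_right g⁻¹ |>.image_mem_nhds hU

theorem compact_cover_step {G X : Type*} [MetricSpace G] [TopologicalSpace X] [CompactSpace X]
    (p : G → X) (ho : IsOpenMap p) (U : Set G) (hU : IsOpen U) (hp : p '' U = univ)
    (ε : ℝ) (hε : 0 < ε) :
    ∃ V : Set G, IsOpen V ∧ p '' V = univ ∧ closure V ⊆ U ∧
      ∃ t : Set G, t.Finite ∧ closure V ⊆ ⋃ g ∈ t, Metric.closedBall g ε := by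
  have : ∀ g : U, ∃ r : ℝ, 0 < r ∧ r ≤ ε ∧ Metric.closedBall (g : G) r ⊆ U := by
    rintro ⟨g, hg⟩
    obtain ⟨r, hr, h⟩ := Metric.nhds_basis_closedBall.mem_iff.1 (hU.mem_nhds hg)
    exact ⟨min r ε, lt_min hr hε, min_le_right _ _,
      (Metric.closedBall_subset_closedBall (min_le_left _ _)).trans h⟩
  choose r hr hrε hrU using this
  obtain ⟨t, ht⟩ := isCompact_univ.elim_finite_subcover
    (fun g : U => p '' Metric.ball (g : G) (r g)) (fun g => ho _ Metric.isOpen_ball) (by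
      intro y _
      obtain ⟨g, hg, rfl⟩ := hp.symm ▸ mem_univ y
      exact mem_iUnion.2 ⟨⟨g, hg⟩, g, Metric.mem_ball_self (hr _), rfl⟩)
  have hcl : closure (⋃ g ∈ t, Metric.ball (g : G) (r g)) ⊆
      ⋃ g ∈ t, Metric.closedBall (g : G) (r g) := by
    apply closure_minimal
    · exact iUnion₂_mono fun g _ => Metric.ball_subset_closedBall
    · exact t.finite_toSet.isClosed_biUnion fun g _ => Metric.isClosed_closedBall
  refine ⟨⋃ g ∈ t, Metric.ball (g : G) (r g), isOpen_biUnion fun _ _ => Metric.isOpen_ball, ?_,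
    hcl.trans (iUnion₂_subset fun g _ => hrU g), (fun g : U => (g : G)) '' t,
    t.finite_toSet.image _, ?_⟩
  · rw [image_iUnion₂]
    exact univ_subset_iff.1 ht
  · rw [biUnion_image]
    exact hcl.trans (iUnion₂_mono fun g _ => Metric.closedBall_subset_closedBall (hrε g))

theorem compact_cover {G X : Type*} [MetricSpace G] [CompleteSpace G] [TopologicalSpace X]
    [T1Space X] [CompactSpace X]
    (p : G → X) (hc : Continuous p) (ho : IsOpenMap p) (hp : Function.Surjective p) :
    ∃ K : Set G, IsCompact K ∧ p '' K = univ := by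
  let P : Set G → Prop := fun U => IsOpen U ∧ p '' U = univ
  have step : ∀ (n : ℕ) (U : Set G), P U → ∃ V : Set G, P V ∧ closure V ⊆ U ∧
      ∃ t : Set G, t.Finite ∧ closure V ⊆ ⋃ g ∈ t, Metric.closedBall g (1 / ((n : ℝ) + 1)) := by
    intro n U hU
    obtain ⟨V, h1, h2, h3⟩ := compact_cover_step p ho U hU.1 hU.2 (1 / ((n : ℝ) + 1))
      (by positivity)
    exact ⟨V, ⟨h1, h2⟩, h3⟩
  choose! f hf using step
  let s : ℕ → Set G := fun n => Nat.rec univ (fun n p => f n p) n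
  have hs : ∀ n, s (n+1) = f n (s n) := fun n => rfl
  have hP : ∀ n, P (s n) := by
    intro n
    induction n with
    | zero => exact ⟨isOpen_univ, by simpa [s] using hp.range_eq⟩
    | succ n ih => rw [hs]; exact (hf n _ ih).1
  have hanti : Antitone s := antitone_nat_of_succ_le fun n =>
    subset_closure.trans (hf n _ (hP n)).2.1
  have htb : ∀ n, ∃ t : Set G, t.Finite ∧
      closure (s (n+1)) ⊆ ⋃ g ∈ t, Metric.closedBall g (1 / ((n : ℝ) + 1)) :=
    fun n => (hf n _ (hP n)).2.2
  -- any sequence of points eventually in every `s n` is totally bounded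
  have key : ∀ K : Set G, (∀ n, (K \ closure (s n)).Finite) → TotallyBounded K := by
    intro K hK
    rw [Metric.totallyBounded_iff]
    intro ε hε
    obtain ⟨n, hn⟩ := exists_nat_one_div_lt hε
    obtain ⟨t, ht, hsub⟩ := htb n
    refine ⟨t ∪ (K \ closure (s (n+1))), ht.union (hK (n+1)), fun g hg => ?_⟩
    by_cases hgs : g ∈ closure (s (n+1))
    · obtain ⟨u, hu, hgu⟩ := mem_iUnion₂.1 (hsub hgs)
      exact mem_iUnion₂.2 ⟨u, Or.inl hu, Metric.closedBall_subset_ball hn hgu⟩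
    · exact mem_iUnion₂.2 ⟨g, Or.inr ⟨hg, hgs⟩, Metric.mem_ball_self hε⟩
  refine ⟨⋂ n, closure (s n), ?_, ?_⟩
  · apply TotallyBounded.isCompact_of_isClosed
    · apply key
      intro n
      rw [sdiff_eq_empty.2 (iInter_subset _ n)]
      exact finite_empty
    · exact isClosed_iInter fun n => isClosed_closure
  · apply eq_univ_of_forall
    intro y
    have : ∀ n, ∃ a ∈ s n, p a = y := fun n => by
      have : y ∈ p '' s n := by rw [(hP n).2]; trivial
      exact this
    choose a ha hay using this
    have hT : TotallyBounded (range a) := by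
      apply key
      intro n
      refine ((finite_lt_nat n).image a).subset ?_
      rintro _ ⟨⟨m, rfl⟩, hm⟩
      refine ⟨m, ?_, rfl⟩
      by_contra hnm
      exact hm (subset_closure (hanti (not_lt.1 hnm) (ha m)))
    have hcomp : IsCompact (closure (range a)) :=
      TotallyBounded.isCompact_of_isClosed hT.closure isClosed_closure
    obtain ⟨b, -, φ, hφ, hb⟩ := hcomp.tendsto_subseq (fun n => subset_closure (mem_range_self n))
    refine ⟨b, mem_iInter.2 fun n => ?_, ?_⟩
    · refine mem_closure_of_tendsto hb ?_
      filter_upwards [eventually_ge_atTop n] with m hm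
      exact hanti (hm.trans (hφ.id_le m)) (ha _)
    · have h1 : IsClosed (p ⁻¹' {y}) := isClosed_singleton.preimage hc
      exact h1.mem_of_tendsto hb (Eventually.of_forall fun m => hay _)

/-- A homeomorphism together with its inverse. -/
def homeoPair {X : Type*} [TopologicalSpace X] (f : X ≃ₜ X) : C(X, X) × C(X, X) :=
  ((f : C(X, X)), (f.symm : C(X, X)))

theorem homeoPair_injective {X : Type*} [TopologicalSpace X] :
    Function.Injective (homeoPair (X := X)) := by
  intro f g h
  ext x
  exact DFunLike.congr_fun (congrArg Prod.fst h) x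

theorem isClosed_range_homeoPair {X : Type*} [MetricSpace X] [CompactSpace X] :
    IsClosed (range (homeoPair (X := X))) := by
  have : range (homeoPair (X := X)) = {p | p.1.comp p.2 = ContinuousMap.id X} ∩
      {p | p.2.comp p.1 = ContinuousMap.id X} := by
    ext ⟨f, g⟩
    constructor
    · rintro ⟨h, hh⟩
      obtain ⟨rfl, rfl⟩ := Prod.mk.inj hh
      constructor <;> ext x <;> simp
    · rintro ⟨h1, h2⟩
      refine ⟨⟨⟨f, g, fun x => DFunLike.congr_fun h2 x, fun x => DFunLike.congr_fun h1 x⟩,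
        f.continuous, g.continuous⟩, rfl⟩
  rw [this]
  apply IsClosed.inter
  · exact isClosed_eq (continuous_fst.compCM continuous_snd) continuous_const
  · exact isClosed_eq (continuous_snd.compCM continuous_fst) continuous_const

/-- In a homogeneous compact metric space, for each `x` there is a compact family
`𝓕 ⊆ H(X,X)` (with the uniform metric) such that every `y ∈ X` is of the form `f x` for some
`f ∈ 𝓕`. -/
theorem exists_compact_transitive_family {X : Type*} [MetricSpace X] [CompactSpace X]
    (hhom : ∀ x y : X, ∃ f : X ≃ₜ X, f x = y) (x : X) :
    ∃ 𝓕 : Set C(X, X), IsCompact 𝓕 ∧ 𝓕 ⊆ HSet X ∧ ∀ y : X, ∃ f ∈ 𝓕, f x = y := by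
  let _ : MetricSpace (X ≃ₜ X) := MetricSpace.induced homeoPair homeoPair_injective inferInstance
  have hind : IsUniformInducing (homeoPair (X := X)) := ⟨rfl⟩
  have hcont : Continuous (homeoPair (X := X)) := hind.uniformContinuous.continuous
  have hc1 : Continuous (fun f : X ≃ₜ X => (f : C(X, X))) := continuous_fst.comp hcont
  have hc2 : Continuous (fun f : X ≃ₜ X => (f.symm : C(X, X))) := continuous_snd.comp hcont
  have : CompleteSpace (X ≃ₜ X) :=
    (completeSpace_iff_isComplete_range hind).2 isClosed_range_homeoPair.isComplete
  have : SecondCountableTopology (X ≃ₜ X) := hind.isInducing.secondCountableTopology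
  have : IsTopologicalGroup (X ≃ₜ X) :=
    { continuous_mul := by
        rw [hind.isInducing.continuous_iff]
        exact ((hc1.comp continuous_fst).compCM (hc1.comp continuous_snd)).prodMk
          ((hc2.comp continuous_snd).compCM (hc2.comp continuous_fst))
      continuous_inv := by
        rw [hind.isInducing.continuous_iff]
        exact hc2.prodMk hc1 }
  let _ : MulAction (X ≃ₜ X) X :=
    { smul := fun f x => f x
      one_smul := fun _ => rfl
      mul_smul := fun _ _ _ => rfl }
  have : ContinuousSMul (X ≃ₜ X) X :=
    ⟨(continuous_eval (F := C(X, X))).comp ((hc1.comp continuous_fst).prodMk continuous_snd)⟩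
  have : MulAction.IsPretransitive (X ≃ₜ X) X := ⟨hhom⟩
  obtain ⟨K, hK, hKx⟩ := compact_cover (fun f : X ≃ₜ X => f • x) (by fun_prop) (effros_open x)
    (hhom x)
  refine ⟨(fun f : X ≃ₜ X => (f : C(X, X))) '' K, hK.image hc1, ?_, fun y => ?_⟩
  · rintro _ ⟨f, -, rfl⟩
    exact f.isHomeomorph
  · obtain ⟨f, hf, hfy⟩ := hKx.symm ▸ mem_univ y
    exact ⟨_, ⟨f, hf, rfl⟩, hfy⟩
end

section
/- Every Slovak space is a non-degenerate continuum, i.e. it is connected and has more than one point. -/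
open Set Filter Topology

theorem hzpow_nat_comm {X : Type*} [TopologicalSpace X] (T : X ≃ₜ X) (n : ℕ) (x : X) :
    ((fun S : X ≃ₜ X => S.trans T)^[n] (Homeomorph.refl X)) (T x)
      = T (((fun S : X ≃ₜ X => S.trans T)^[n] (Homeomorph.refl X)) x) := by
  induction n with
  | zero => rfl
  | succ k ih =>
    rw [Function.iterate_succ_apply']
    simp only [Homeomorph.trans_apply]
    rw [ih]

theorem hzpow_comm {X : Type*} [TopologicalSpace X] (T : X ≃ₜ X) (n : ℤ) (x : X) :
    hzpow T n (T x) = T (hzpow T n x) := by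
  cases n with
  | ofNat n => exact hzpow_nat_comm T n x
  | negSucc n =>
    simp only [hzpow]
    rw [Homeomorph.symm_apply_eq, hzpow_nat_comm, Homeomorph.apply_symm_apply]

theorem fixed_eq_id {X : Type*} [TopologicalSpace X] [T2Space X] (T : X ≃ₜ X)
    (hmin : IsMinimal ⇑T) (S : X → X) (hS : Continuous S) (hc : ∀ x, S (T x) = T (S x))
    (x : X) (hx : S x = x) (y : X) : S y = y := by
  have h : S = id := by
    refine Continuous.ext_on (hmin x) hS continuous_id ?_
    rintro _ ⟨n, rfl⟩
    induction n with
    | zero => exact hx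
    | succ k ih =>
      simp only [Function.iterate_succ_apply', id] at ih ⊢
      rw [hc, ih]
  rw [h]; rfl

open Classical in
theorem continuous_ite_clopen {X : Type*} [TopologicalSpace X] {B : Set X} (hB : IsClopen B)
    {f g : X → X} (hf : Continuous f) (hg : Continuous g) :
    Continuous (fun x => if x ∈ B then f x else g x) := by
  refine Continuous.if ?_ hf hg
  intro a ha
  have : a ∈ frontier B := ha
  rw [hB.frontier_eq] at this
  exact this.elim

/-- Every Slovak space is a non-degenerate continuum: it is connected and has more than one
point. -/
theorem slovak_is_continuum {X : Type*} [MetricSpace X] [CompactSpace X]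
    (hcard : ∃ a b c : X, a ≠ b ∧ a ≠ c ∧ b ≠ c)
    (T : X ≃ₜ X) (hmin : IsMinimal ⇑T)
    (hgen : ∀ S : X ≃ₜ X, ∃ n : ℤ, S = hzpow T n) :
    ConnectedSpace X ∧ Nontrivial X := by
  classical
  obtain ⟨a, b, c, hab, hac, hbc⟩ := hcard
  refine ⟨?_, ⟨a, b, hab⟩⟩
  have key : ∀ (S : X ≃ₜ X) (x : X), S x = x → ∀ y, S y = y := by
    intro S x hx y
    obtain ⟨n, rfl⟩ := hgen S
    exact fixed_eq_id T hmin _ (hzpow T n).continuous (hzpow_comm T n) x hx y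
  have hT2 : ∀ x, T (T x) ≠ x := by
    intro x hx
    have hsub : (Set.range fun n : ℕ => T^[n] x) ⊆ {x, T x} := by
      rintro _ ⟨n, rfl⟩
      induction n with
      | zero => simp
      | succ k ih =>
        simp only [Function.iterate_succ_apply', mem_insert_iff, mem_singleton_iff] at ih ⊢
        rcases ih with h | h <;> rw [h]
        · exact Or.inr rfl
        · exact Or.inl hx
    have hfin : ({x, T x} : Set X).Finite := by simp
    have hall : ∀ y, y = x ∨ y = T x := by
      intro y
      have h1 := (hmin x).mono hsub
      have h2 : closure ({x, T x} : Set X) = {x, T x} := hfin.isClosed.closure_eq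
      have h3 := h1 y
      rw [h2] at h3
      simpa using h3
    have ha := hall a
    have hb := hall b
    have hc := hall c
    grind
  haveI : Nonempty X := ⟨a⟩
  haveI : PreconnectedSpace X := by
    rw [preconnectedSpace_iff_clopen]
    intro A hA
    by_contra! hne
    obtain ⟨hA0, hA1⟩ := hne
    obtain ⟨B, hBdef⟩ : ∃ B : Set X, B = A \ T ⁻¹' A := ⟨_, rfl⟩
    have hB : IsClopen B := hBdef ▸ hA.diff (hA.preimage T.continuous)
    have hBT : ∀ x, x ∈ B → T x ∉ B := by
      intro x hx hx'
      rw [hBdef] at hx hx'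
      exact hx.2 hx'.1
    obtain ⟨p, hp⟩ : B.Nonempty := by
      by_contra hemp
      apply hA1
      have hstep : ∀ x ∈ A, T x ∈ A := by
        intro x hx
        by_contra hx'
        exact hemp ⟨x, hBdef ▸ ⟨hx, hx'⟩⟩
      obtain ⟨x, hx⟩ := nonempty_iff_ne_empty.2 (by simpa [nonempty_iff_ne_empty] using hA0)
      have hsub : (Set.range fun n : ℕ => T^[n] x) ⊆ A := by
        rintro _ ⟨n, rfl⟩
        induction n with
        | zero => exact hx
        | succ k ih =>
          simp only [Function.iterate_succ_apply']
          exact hstep _ ih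
      have := ((hmin x).mono hsub).closure_eq
      rwa [hA.isClosed.closure_eq] at this
    by_cases hcov : ∃ q, q ∉ B ∧ T.symm q ∉ B
    · obtain ⟨q, hq, hq'⟩ := hcov
      let f : X → X := fun x => if x ∈ B then T x else
        (if x ∈ T.symm ⁻¹' B then T.symm x else x)
      have hf : Continuous f := continuous_ite_clopen hB T.continuous
        (continuous_ite_clopen (hB.preimage T.symm.continuous) T.symm.continuous continuous_id)
      have hff : ∀ x, f (f x) = x := by
        intro x
        by_cases h1 : x ∈ B
        · have h2 := hBT x h1
          simp [f, h1, h2]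
        · by_cases h2 : T.symm x ∈ B
          · simp [f, h1, h2]
          · simp [f, h1, h2]
      let S : X ≃ₜ X := ⟨⟨f, f, hff, hff⟩, hf, hf⟩
      have h1 : f p = p := key S q (by change f q = q; simp [f, hq, hq']) p
      have h2 : f p = T p := by simp [f, hp]
      apply hBT p hp
      rw [← h2, h1]
      exact hp
    · push Not at hcov
      have hTB : ∀ x, x ∉ B → T x ∈ B := by
        intro x hx
        by_contra h
        have := hcov _ h
        rw [Homeomorph.symm_apply_apply] at this
        exact hx this
      have hsB : ∀ x, x ∈ B → T.symm (T.symm x) ∈ B := by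
        intro x hx
        apply hcov
        intro h
        have := hBT _ h
        rw [Homeomorph.apply_symm_apply] at this
        exact this hx
      let f : X → X := fun x => if x ∈ B then T (T x) else x
      let g : X → X := fun x => if x ∈ B then T.symm (T.symm x) else x
      have hf : Continuous f :=
        continuous_ite_clopen hB (T.continuous.comp T.continuous) continuous_id
      have hg : Continuous g :=
        continuous_ite_clopen hB (T.symm.continuous.comp T.symm.continuous) continuous_id
      have hgf : ∀ x, g (f x) = x := by
        intro x
        by_cases h1 : x ∈ B
        · simp [f, g, h1, hTB _ (hBT _ h1)]
        · simp [f, g, h1]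
      have hfg : ∀ x, f (g x) = x := by
        intro x
        by_cases h1 : x ∈ B
        · simp [f, g, h1, hsB _ h1]
        · simp [f, g, h1]
      let S : X ≃ₜ X := ⟨⟨f, g, hgf, hfg⟩, hf, hg⟩
      have h1 : f p = p := key S (T p) (by change f (T p) = T p; simp [f, hBT p hp]) p
      have h2 : f p = T (T p) := by simp [f, hp]
      exact hT2 p (h2 ▸ h1)
  exact ⟨inferInstance⟩
end

section
/- Let X be a compact metric space whose group of self-homeomorphisms is countable. Then for every homeomorphism T : X → X, the topological entropy of F_T on H(X,X) is zero. -/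
open Set Filter Topology

lemma exists_isolated_pair {X : Type*} [MetricSpace X] [CompactSpace X]
    (hc : (HSet X).Countable) : ∃ f g : C(X, X), f.comp g = ContinuousMap.id X ∧
      g.comp f = ContinuousMap.id X ∧ ∃ ε > 0, ∀ f' g' : C(X, X),
      f'.comp g' = ContinuousMap.id X → g'.comp f' = ContinuousMap.id X →
      dist f' f < ε → dist g' g < ε → f' = f := by
  let P : Set (C(X, X) × C(X, X)) :=
    {p | p.1.comp p.2 = ContinuousMap.id X ∧ p.2.comp p.1 = ContinuousMap.id X}
  have hcl : IsClosed P := by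
    apply IsClosed.inter
    · exact isClosed_eq (continuous_fst.compCM continuous_snd) continuous_const
    · exact isClosed_eq (continuous_snd.compCM continuous_fst) continuous_const
  have hcount : P.Countable := by
    refine MapsTo.countable_of_injOn (f := Prod.fst) (t := HSet X) ?_ ?_ hc
    · rintro ⟨f, g⟩ ⟨h1, h2⟩
      exact (Homeomorph.mk (Equiv.mk f g (fun x => DFunLike.congr_fun h2 x)
        (fun x => DFunLike.congr_fun h1 x)) f.continuous g.continuous).isHomeomorph
    · rintro ⟨f, g⟩ ⟨h1, h2⟩ ⟨f', g'⟩ ⟨h3, h4⟩ (h : f = f')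
      subst h
      refine Prod.ext rfl ?_
      change g = g'
      calc g = g.comp (f.comp g') := by rw [h3]; rfl
        _ = (g.comp f).comp g' := rfl
        _ = g' := by rw [h2]; rfl
  have : CompleteSpace P := hcl.completeSpace_coe
  have : Countable P := hcount.to_subtype
  have : Nonempty P := ⟨⟨(ContinuousMap.id X, ContinuousMap.id X), rfl, rfl⟩⟩
  obtain ⟨x, hx⟩ := nonempty_interior_of_iUnion_of_closed (X := P) (f := fun x : P => {x})
    (fun _ => isClosed_singleton) (by ext; simp)
  obtain ⟨y, hy⟩ := hx
  have hyx : y = x := mem_singleton_iff.1 (interior_subset hy)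
  subst hyx
  obtain ⟨ε, hε, hb⟩ := Metric.mem_nhds_iff.1 (mem_interior_iff_mem_nhds.1 hy)
  refine ⟨y.1.1, y.1.2, y.2.1, y.2.2, ε, hε, fun f' g' h1 h2 h3 h4 => ?_⟩
  have : (⟨(f', g'), h1, h2⟩ : P) ∈ Metric.ball y ε := by
    rw [Metric.mem_ball, Subtype.dist_eq, Prod.dist_eq]
    exact max_lt h3 h4
  have := hb this
  rw [mem_singleton_iff] at this
  rw [← this]

lemma exists_nhds_isolated {X : Type*} [MetricSpace X] [CompactSpace X]
    (hc : (HSet X).Countable) (f : C(X, X)) (hf : f ∈ HSet X) :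
    ∃ U ∈ 𝓝 f, ∀ g ∈ U, g ∈ HSet X → g = f := by
  obtain ⟨f₀, g₀, h1, h2, ε, hε, H⟩ := exists_isolated_pair hc
  obtain ⟨e, rfl⟩ : ∃ e : X ≃ₜ X, (e : C(X, X)) = f :=
    ⟨hf.homeomorph, by ext; rfl⟩
  let i : C(X, X) := (e.symm : C(X, X))
  have c1 : Continuous fun g : C(X, X) => i.comp g := continuous_const.compCM continuous_id
  have c2 : Continuous fun g : C(X, X) => f₀.comp (i.comp g) := continuous_const.compCM c1
  have hi : i.comp (e : C(X, X)) = ContinuousMap.id X := by ext x; simp [i]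
  refine ⟨{g | dist (f₀.comp (i.comp g)) f₀ < ε} ∩
    {g | dist (i.comp g) (ContinuousMap.id X) < ε}, ?_, ?_⟩
  · refine IsOpen.mem_nhds ((isOpen_lt (c2.dist continuous_const) continuous_const).inter
      (isOpen_lt (c1.dist continuous_const) continuous_const)) ⟨?_, ?_⟩
    · simp [hi, hε]
    · simp [hi, hε]
  · rintro g ⟨hg1, hg2⟩ hg
    obtain ⟨k, rfl⟩ : ∃ k : X ≃ₜ X, (k : C(X, X)) = g :=
      ⟨hg.homeomorph, by ext; rfl⟩
    have h1' : ∀ x, f₀ (g₀ x) = x := fun x => DFunLike.congr_fun h1 x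
    have h2' : ∀ x, g₀ (f₀ x) = x := fun x => DFunLike.congr_fun h2 x
    have key := H (f₀.comp (i.comp (k : C(X, X))))
      ((k.symm : C(X, X)).comp ((e : C(X, X)).comp g₀))
      (by ext x; simp [i, h1']) (by ext x; simp [i, h2']) hg1 (by
        rw [mem_setOf_eq, ContinuousMap.dist_lt_iff hε] at hg2
        rw [ContinuousMap.dist_lt_iff hε]
        intro x
        have := hg2 (k.symm (e (g₀ x)))
        rw [dist_comm]
        simpa [i] using this)
    ext x
    have h3 : f₀ (e.symm (k x)) = f₀ x := DFunLike.congr_fun key x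
    have h4 : e.symm (k x) = x := by rw [← h2' (e.symm (k x)), h3, h2']
    change k x = e x
    exact (e.symm_apply_eq).1 h4

lemma finite_of_compact {X : Type*} [MetricSpace X] [CompactSpace X]
    (hc : (HSet X).Countable) (K : Set C(X, X)) (hK : IsCompact K) (hKH : K ⊆ HSet X) :
    K.Finite := by
  choose! U hU hU' using exists_nhds_isolated hc
  obtain ⟨t, ht, hcov⟩ := hK.elim_nhds_subcover U (fun x hx => hU x (hKH hx))
  refine t.finite_toSet.subset fun g hg => ?_
  obtain ⟨f, hf, hgf⟩ := mem_iUnion₂.1 (hcov hg)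
  rw [hU' f (hKH (ht f hf)) g hgf (hKH hg)]
  exact hf

lemma entropyOnSet_finite {Z : Type*} [PseudoMetricSpace Z] (S : Z → Z) (K : Set Z)
    (hK : K.Finite) : entropyOnSet S K = 0 := by
  have key : ∀ ε : ℝ, Filter.atTop.limsup
      (fun n : ℕ => ((Real.log (sepNum S n ε K) / n : ℝ) : EReal)) = 0 := by
    intro ε
    apply Tendsto.limsup_eq
    have hb : ∀ n, sepNum S n ε K ≤ K.ncard := by
      intro n
      apply csSup_le'
      rintro m ⟨E, hE, -, rfl⟩
      rw [← ncard_coe_finset]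
      exact ncard_le_ncard hE hK
    have : Tendsto (fun n : ℕ => Real.log (sepNum S n ε K) / n) atTop (𝓝 0) := by
      refine squeeze_zero (fun n => div_nonneg (Real.log_natCast_nonneg _) n.cast_nonneg)
        (fun n => ?_) (tendsto_const_div_atTop_nhds_zero_nat (K.ncard : ℝ))
      gcongr
      exact (Real.log_le_self (Nat.cast_nonneg _)).trans (by exact_mod_cast hb n)
    exact (continuous_coe_real_ereal.tendsto 0).comp this
  unfold entropyOnSet
  simp only [key]
  apply le_antisymm
  · exact iSup₂_le fun _ _ => le_rfl
  · exact le_iSup₂_of_le 1 one_pos le_rfl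

/-- If the group of self-homeomorphisms of a compact metric space is countable, then for every
homeomorphism `T` the functional envelope `(H(X,X), F_T)` has entropy zero. -/
theorem envelope_entropy_zero_of_countable {X : Type*} [MetricSpace X] [CompactSpace X]
    (hc : (HSet X).Countable) (T : X ≃ₜ X) :
    entropyOn (envMap T) (HSet X) = 0 := by
  unfold entropyOn
  apply le_antisymm
  · refine iSup_le fun K => iSup₂_le fun hK hKH => ?_
    exact (entropyOnSet_finite _ K (finite_of_compact hc K hK hKH)).le
  · refine le_iSup_of_le ∅ (le_iSup₂_of_le isCompact_empty (empty_subset _) ?_)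
    exact (entropyOnSet_finite _ ∅ finite_empty).ge
end

section
/- Let X be a compact metric space. If the group H(X,X) of self-homeomorphisms of X, equipped with the uniform metric, is countable, then H(X,X) is a discrete topological space (every singleton is open). -/
open Set Filter Topology

/-- If the group `H(X,X)` of self-homeomorphisms of a compact metric space, with the uniform
metric, is countable, then it is discrete: every element is isolated in `H(X,X)`. -/
theorem homeo_group_discrete_of_countable {X : Type*} [MetricSpace X] [CompactSpace X]
    (hc : (HSet X).Countable) :
    ∀ f ∈ HSet X, ∃ ε : ℝ, 0 < ε ∧ ∀ g ∈ HSet X, dist g f < ε → g = f := by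
  classical
  have inv : ∀ f ∈ HSet X, ∃ g : C(X, X), (∀ x, f (g x) = x) ∧ (∀ x, g (f x) = x) := by
    intro f hf
    let e := IsHomeomorph.homeomorph f hf
    refine ⟨⟨e.symm, e.symm.continuous⟩, fun x => ?_, fun x => ?_⟩
    · exact e.apply_symm_apply x
    · exact e.symm_apply_apply x
  let P : Set (C(X, X) × C(X, X)) :=
    {p | (∀ x, p.1 (p.2 x) = x) ∧ (∀ x, p.2 (p.1 x) = x)}
  have hPH : ∀ p ∈ P, p.1 ∈ HSet X := by
    intro p hp
    let e : X ≃ₜ X :=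
      { toFun := p.1, invFun := p.2, left_inv := hp.2, right_inv := hp.1,
        continuous_toFun := p.1.continuous, continuous_invFun := p.2.continuous }
    exact e.isHomeomorph
  have hPc : P.Countable := by
    refine MapsTo.countable_of_injOn (f := Prod.fst) (t := HSet X) hPH ?_ hc
    intro p hp q hq hpq
    refine Prod.ext hpq ?_
    ext x
    have h1 := hp.1 x
    have h2 := hq.2 (p.2 x)
    rw [← hpq, h1] at h2
    exact h2.symm
  have hPcl : IsClosed P := by
    have : P = {p | p.1.comp p.2 = ContinuousMap.id X} ∩
        {p | p.2.comp p.1 = ContinuousMap.id X} := by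
      ext p
      simp [P, ContinuousMap.ext_iff]
    rw [this]
    refine IsClosed.inter (isClosed_eq ?_ continuous_const) (isClosed_eq ?_ continuous_const)
    · exact continuous_fst.compCM continuous_snd
    · exact continuous_snd.compCM continuous_fst
  have hPne : Nonempty P := ⟨⟨(ContinuousMap.id X, ContinuousMap.id X), by simp [P]⟩⟩
  have : Countable P := hPc.to_subtype
  have : CompleteSpace P := hPcl.completeSpace_coe
  obtain ⟨p, hp⟩ := nonempty_interior_of_iUnion_of_closed (f := fun p : P => ({p} : Set P))
    (fun p => isClosed_singleton) (by ext q; simp)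
  obtain ⟨q, hq⟩ := hp
  have hqp : q = p := mem_singleton_iff.1 (interior_subset hq)
  subst hqp
  obtain ⟨ε, hε, hball⟩ := Metric.mem_nhds_iff.1 (mem_interior_iff_mem_nhds.1 hq)
  obtain ⟨⟨f0, g0⟩, hP0⟩ := q
  have hfg : ∀ x, f0 (g0 x) = x := hP0.1
  have hgf : ∀ x, g0 (f0 x) = x := hP0.2
  intro h hh
  obtain ⟨k, hk1, hk2⟩ := inv h hh
  have u1 := CompactSpace.uniformContinuous_of_continuous (f0.comp k).continuous
  have u2 := CompactSpace.uniformContinuous_of_continuous k.continuous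
  obtain ⟨δ1, hδ1, H1⟩ := Metric.uniformContinuous_iff.1 u1 ε hε
  obtain ⟨δ2, hδ2, H2⟩ := Metric.uniformContinuous_iff.1 u2 ε hε
  refine ⟨min δ1 δ2, lt_min hδ1 hδ2, fun g hg hd => ?_⟩
  obtain ⟨l, hl1, hl2⟩ := inv g hg
  have hx : ∀ x, dist (g x) (h x) < min δ1 δ2 := fun x =>
    (ContinuousMap.dist_apply_le_dist x).trans_lt hd
  have hmem : ((f0.comp (k.comp g), l.comp (h.comp g0)) : C(X, X) × C(X, X)) ∈ P := by
    constructor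
    · intro x
      simp [hl1, hk2, hfg]
    · intro x
      simp [hgf, hk1, hl2]
  have hb : (⟨_, hmem⟩ : P) ∈ Metric.ball (⟨(f0, g0), hP0⟩ : P) ε := by
    rw [Metric.mem_ball, Subtype.dist_eq, Prod.dist_eq]
    refine max_lt ?_ ?_
    · rw [ContinuousMap.dist_lt_iff hε]
      intro x
      have := H1 ((hx x).trans_le (min_le_left _ _))
      simpa [hk2] using this
    · rw [ContinuousMap.dist_lt_iff hε]
      intro x
      have := H2 ((hx (l (h (g0 x)))).trans_le (min_le_right _ _))
      rw [hk2, hl1, hk2, dist_comm] at this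
      exact this
  have heq : f0.comp (k.comp g) = f0 := by
    have := hball hb
    have := congrArg (fun z : P => z.1.1) (mem_singleton_iff.1 this)
    exact this
  ext x
  have h1 : f0 (k (g x)) = f0 x := DFunLike.congr_fun heq x
  have h2 := congrArg (fun y => h (g0 y)) h1
  simpa [hgf, hk1] using h2
end

section
/- Let T : X → X be a homeomorphism of a compact metric space, x₀ ∈ X a point which is not periodic under T, and f : X∖{x₀} → [0,1] a continuous function. Let (a_n)_{n∈ℤ} be strictly positive reals with Σ_{n∈ℤ} a_n = 1 and sup_{n∈ℤ} a_{n-1}/a_n < ∞. Let X' = X ∖ {T^n x₀ : n ∈ ℤ} and define F : X' → [0,1] by F(x) = Σ_{n∈ℤ} a_n f(T^n x). Then the map sending (x, F(x)) to (T x, F(T x)) is a uniformly continuous self-map of the graph of F, regarded as a subset of X × [0,1] with the product metric. -/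
open Set Filter Topology

theorem hzpow_eq {X : Type*} [TopologicalSpace X] (T : X ≃ₜ X) (n : ℤ) (x : X) :
    hzpow T n x = ((T.toEquiv : Equiv.Perm X) ^ n) x := by
  have key : ∀ k : ℕ, ((fun S : X ≃ₜ X => S.trans T)^[k] (Homeomorph.refl X)).toEquiv
      = (T.toEquiv : Equiv.Perm X) ^ k := by
    intro k
    induction k with
    | zero => rfl
    | succ k ih =>
      rw [Function.iterate_succ_apply', pow_succ', ← ih]
      rfl
  cases n with
  | ofNat k =>
    have := congrArg (fun e : Equiv.Perm X => e x) (key k)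
    simpa [hzpow] using this
  | negSucc k =>
    rw [zpow_negSucc, ← key (k + 1)]
    rfl

theorem hzpow_succ_apply {X : Type*} [TopologicalSpace X] (T : X ≃ₜ X) (n : ℤ) (x : X) :
    hzpow T n (T x) = hzpow T (n + 1) x := by
  rw [hzpow_eq, hzpow_eq, zpow_add_one]
  rfl

theorem hzpow_inj_of_nonperiodic {X : Type*} [TopologicalSpace X] (T : X ≃ₜ X) (x₀ : X)
    (hper : ∀ k : ℕ, 1 ≤ k → (⇑T)^[k] x₀ ≠ x₀) (z : X) (m n : ℤ)
    (hm : hzpow T m z = x₀) (hn : hzpow T n z = x₀) : m = n := by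
  rw [hzpow_eq] at hm hn
  have aux : ∀ i j : ℤ, ((T.toEquiv : Equiv.Perm X) ^ i) z = x₀ →
      ((T.toEquiv : Equiv.Perm X) ^ j) z = x₀ → ¬ i < j := by
    intro i j hi hj hij
    obtain ⟨k, hk⟩ := Int.eq_ofNat_of_zero_le (sub_nonneg.2 hij.le)
    apply hper k (by omega)
    have h1 : j = (k : ℤ) + i := by omega
    rw [h1, zpow_add, Equiv.Perm.mul_apply, hi, zpow_natCast, Equiv.Perm.coe_pow] at hj
    exact hj
  have h1 := aux m n hm hn
  have h2 := aux n m hn hm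
  omega

/-- The local estimate near a point `z`. -/
theorem local_estimate {X : Type*} [MetricSpace X]
    (T : X ≃ₜ X) (x₀ : X) (hper : ∀ k : ℕ, 1 ≤ k → (⇑T)^[k] x₀ ≠ x₀)
    (f : X → ℝ) (hfc : ContinuousOn f {x₀}ᶜ)
    (hf01 : ∀ x : X, x ≠ x₀ → f x ∈ Set.Icc (0 : ℝ) 1)
    (a : ℤ → ℝ) (hapos : ∀ n : ℤ, 0 < a n) (hsummable : Summable a)
    (A : ℝ) (hA : ∀ n : ℤ, a (n - 1) / a n ≤ A) (F : X → ℝ)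
    (hF : F = (fun x => ∑' n : ℤ, a n * f (hzpow T n x))) (z : X) (ε : ℝ) (hε : 0 < ε) :
    ∃ U : Set X, IsOpen U ∧ z ∈ U ∧ ∀ x ∈ U, ∀ y ∈ U, (∀ n, hzpow T n x ≠ x₀) →
      (∀ n, hzpow T n y ≠ x₀) → |F (T x) - F (T y)| ≤ A * |F x - F y| + ε := by
  obtain ⟨m, hm⟩ : ∃ m : ℤ, ∀ n, n ≠ m → hzpow T n z ≠ x₀ := by
    by_cases h : ∃ m, hzpow T m z = x₀
    · obtain ⟨m, hm⟩ := h
      exact ⟨m, fun n hn h => hn (hzpow_inj_of_nonperiodic T x₀ hper z n m h hm)⟩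
    · push Not at h
      exact ⟨0, fun n _ => h n⟩
  set c := a (m - 1) / a m with hc
  have hc0 : 0 ≤ c := (div_pos (hapos _) (hapos _)).le
  set b : ℤ → ℝ := fun n => a (n - 1) - c * a n with hb
  have hbm : b m = 0 := by
    simp only [hb, hc]
    rw [div_mul_cancel₀ _ (hapos m).ne', sub_self]
  have hs' : Summable (fun n => a (n - 1)) :=
    (Equiv.subRight (1 : ℤ)).summable_iff.2 hsummable
  have hbs : Summable b := hs'.sub (hsummable.mul_left c)
  set S : Set X := {x | ∀ n, n ≠ m → hzpow T n x ≠ x₀} with hS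
  have hL : ContinuousOn (fun x => ∑' n : ℤ, b n * f (hzpow T n x)) S := by
    refine continuousOn_tsum (u := fun n => |b n|) ?_ hbs.abs ?_
    · intro n
      by_cases hn : n = m
      · subst hn
        simp only [hbm, zero_mul]
        exact continuousOn_const
      · exact continuousOn_const.mul
          (hfc.comp (hzpow T n).continuous.continuousOn (fun x hx => hx n hn))
    · intro n x hx
      by_cases hn : n = m
      · subst hn
        simp [hbm]
      · have := hf01 _ (hx n hn)
        rw [Real.norm_eq_abs, abs_mul, abs_of_nonneg this.1]
        exact mul_le_of_le_one_right (abs_nonneg _) this.2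
  have hsumm : ∀ (d : ℤ → ℝ), Summable d → ∀ x, (∀ n, hzpow T n x ≠ x₀) →
      Summable (fun n => d n * f (hzpow T n x)) := by
    intro d hd x hx
    refine Summable.of_norm_bounded hd.abs (fun n => ?_)
    have := hf01 _ (hx n)
    rw [Real.norm_eq_abs, abs_mul, abs_of_nonneg this.1]
    exact mul_le_of_le_one_right (abs_nonneg _) this.2
  have hFT : ∀ x, (∀ n, hzpow T n x ≠ x₀) →
      F (T x) = c * F x + ∑' n : ℤ, b n * f (hzpow T n x) := by
    intro x hx
    have h1 : F (T x) = ∑' n : ℤ, a (n - 1) * f (hzpow T n x) := by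
      rw [hF]
      simp only [hzpow_succ_apply]
      rw [← (Equiv.subRight (1 : ℤ)).tsum_eq]
      simp
    rw [h1, hF]
    simp only
    rw [← tsum_mul_left, ← ((hsumm a hsummable x hx).mul_left c).tsum_add (hsumm b hbs x hx)]
    congr 1
    ext n
    simp only [hb]
    ring
  obtain ⟨r, hr, hr'⟩ := Metric.continuousWithinAt_iff.1 (hL z hm) (ε / 2) (half_pos hε)
  refine ⟨Metric.ball z r, Metric.isOpen_ball, Metric.mem_ball_self hr, ?_⟩
  intro x hx y hy hx' hy'
  have h1 := hr' (fun n _ => hx' n) hx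
  have h2 := hr' (fun n _ => hy' n) hy
  rw [hFT x hx', hFT y hy']
  have h3 := dist_triangle_right (∑' n : ℤ, b n * f (hzpow T n x))
    (∑' n : ℤ, b n * f (hzpow T n y)) (∑' n : ℤ, b n * f (hzpow T n z))
  set p := ∑' n : ℤ, b n * f (hzpow T n x)
  set q := ∑' n : ℤ, b n * f (hzpow T n y)
  have h4 : |p - q| ≤ ε := by
    rw [← Real.dist_eq]; linarith
  have h5 : c * |F x - F y| ≤ A * |F x - F y| :=
    mul_le_mul_of_nonneg_right (hA m) (abs_nonneg _)
  calc |c * F x + p - (c * F y + q)| = |c * (F x - F y) + (p - q)| := by ring_nf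
    _ ≤ |c * (F x - F y)| + |p - q| := abs_add_le _ _
    _ = c * |F x - F y| + |p - q| := by rw [abs_mul, abs_of_nonneg hc0]
    _ ≤ _ := by linarith

/-- Lemma on uniform continuity: with `T` a homeomorphism of a compact metric space, `x₀` a
non-periodic point, `f` continuous off `x₀` with values in `[0,1]`, and positive coefficients
`(a_n)` summing to `1` with bounded ratios `a_{n-1}/a_n`, the map
`(x, F x) ↦ (T x, F (T x))` is a uniformly continuous self-map of the graph of
`F = Σ_n a_n · f ∘ Tⁿ` (defined on the complement `X'` of the orbit of `x₀`), as a subset of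
`X × ℝ` with the product metric. -/
theorem graph_map_uniformly_continuous {X : Type*} [MetricSpace X] [CompactSpace X]
    (T : X ≃ₜ X) (x₀ : X) (hper : ∀ k : ℕ, 1 ≤ k → (⇑T)^[k] x₀ ≠ x₀)
    (f : X → ℝ) (hfc : ContinuousOn f {x₀}ᶜ)
    (hf01 : ∀ x : X, x ≠ x₀ → f x ∈ Set.Icc (0 : ℝ) 1)
    (a : ℤ → ℝ) (hapos : ∀ n : ℤ, 0 < a n) (hsummable : Summable a)
    (hsum : ∑' n : ℤ, a n = 1)
    (hratio : ∃ A : ℝ, ∀ n : ℤ, a (n - 1) / a n ≤ A) :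
    ∀ (F : X → ℝ) (G : Set (X × ℝ)),
      F = (fun x => ∑' n : ℤ, a n * f (hzpow T n x)) →
      G = {p : X × ℝ | (∀ n : ℤ, hzpow T n x₀ ≠ p.1) ∧ p.2 = F p.1} →
      Set.MapsTo (fun p : X × ℝ => (T p.1, F (T p.1))) G G ∧
        UniformContinuousOn (fun p : X × ℝ => (T p.1, F (T p.1))) G := by
  obtain ⟨A, hA⟩ := hratio
  intro F G hF hG
  have orb : ∀ x : X, (∀ n : ℤ, hzpow T n x₀ ≠ x) → ∀ n : ℤ, hzpow T n x ≠ x₀ := by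
    intro x hx n hn
    apply hx (-n)
    rw [hzpow_eq] at hn ⊢
    rw [← hn, ← Equiv.Perm.mul_apply, ← zpow_add]
    simp
  have hA0 : 0 ≤ A := (div_pos (hapos _) (hapos _)).le.trans (hA 0)
  refine ⟨?_, ?_⟩
  · intro p hp
    rw [hG] at hp ⊢
    refine ⟨fun n hn => hp.1 (n - 1) ?_, rfl⟩
    apply T.injective
    replace hn : hzpow T n x₀ = T p.1 := hn
    rw [← hn, hzpow_eq, hzpow_eq]
    have : n = 1 + (n - 1) := by ring
    conv_rhs => rw [this, zpow_add, zpow_one]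
    rfl
  · rw [Metric.uniformContinuousOn_iff]
    intro ε hε
    choose U hUo hzU hU using fun z => local_estimate T x₀ hper f hfc hf01 a hapos hsummable A hA
      F hF z (ε / 2) (half_pos hε)
    obtain ⟨δ₁, hδ₁, hleb⟩ := lebesgue_number_lemma_of_metric (isCompact_univ (X := X)) hUo
      (fun z _ => mem_iUnion.2 ⟨z, hzU z⟩)
    obtain ⟨δ₂, hδ₂, hT⟩ := Metric.uniformContinuous_iff.1
      (CompactSpace.uniformContinuous_of_continuous T.continuous) ε hε
    have hδ₃ : 0 < ε / (2 * (A + 1)) := by positivity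
    refine ⟨min δ₁ (min δ₂ (ε / (2 * (A + 1)))), lt_min hδ₁ (lt_min hδ₂ hδ₃), ?_⟩
    intro p hp q hq hpq
    rw [hG] at hp hq
    rw [Prod.dist_eq, max_lt_iff, lt_min_iff, lt_min_iff, lt_min_iff, lt_min_iff] at hpq
    obtain ⟨⟨h1, h2, -⟩, -, -, h3⟩ := hpq
    rw [Prod.dist_eq, max_lt_iff]
    refine ⟨hT h2, ?_⟩
    obtain ⟨z, hz⟩ := hleb p.1 (mem_univ _)
    have key := hU z p.1 (hz (Metric.mem_ball_self hδ₁)) q.1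
      (hz (by rw [Metric.mem_ball, dist_comm]; exact h1)) (orb _ hp.1) (orb _ hq.1)
    rw [hp.2, hq.2, Real.dist_eq, lt_div_iff₀ (by positivity)] at h3
    show dist (F (T p.1)) (F (T q.1)) < ε
    rw [Real.dist_eq]
    by_cases h0 : |F p.1 - F q.1| = 0
    · rw [h0] at key
      linarith
    · have : 0 < |F p.1 - F q.1| := lt_of_le_of_ne (abs_nonneg _) (Ne.symm h0)
      nlinarith
end
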